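/- For every integer n ≥ 16 there exists a conflict collection of n-vertex graphs of cardinality at most ⌊(log₂(t_s(n,2)) − (n−4) − log₂((n−3)!)) / (n − log₂(16n(n−1)(n−2)))⌋ + 2. -/

import Mathlib

noncomputable section

/-- The Euclidean plane. -/
abbrev Plane := EuclideanSpace ℝ (Fin 2)

/-- `π` is a straight-line embedding of the simple graph `G` in the plane:
it is injective, the closed segments of two distinct edges meet only in images of
common endpoints, and no vertex image lies in the open segment of a non-incident edge. -/
def IsSLEmbedding {V : Type*} (G : SimpleGraph V) (π : V → Plane) : Prop :=
  Function.Injective π ∧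
  (∀ u v x y : V, G.Adj u v → G.Adj x y → s(u, v) ≠ s(x, y) →
    segment ℝ (π u) (π v) ∩ segment ℝ (π x) (π y) ⊆ π '' (({u, v} : Set V) ∩ ({x, y} : Set V))) ∧
  (∀ u v w : V, G.Adj u v → w ≠ u → w ≠ v → π w ∉ openSegment ℝ (π u) (π v))

/-- `G` embeds straight-line on the point set `P`. -/
def EmbedsOn {V : Type*} (G : SimpleGraph V) (P : Set Plane) : Prop :=
  ∃ π : V → Plane, IsSLEmbedding G π ∧ Set.range π = P

/-- `G` embeds straight-line on some point set (equivalently, `G` is planar). -/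
def PlanarEmbeddable {V : Type*} (G : SimpleGraph V) : Prop :=
  ∃ π : V → Plane, IsSLEmbedding G π

/-- A family of graphs on `n` vertices is simultaneously embeddable if there is a point
set of size `n` on which every member embeds straight-line. -/
def SimultaneouslyEmbeddable {n : ℕ} (𝒢 : Set (SimpleGraph (Fin n))) : Prop :=
  ∃ P : Finset Plane, P.card = n ∧ ∀ G ∈ 𝒢, EmbedsOn G ↑P

/-- A conflict collection: a family of planar-embeddable graphs on `n` vertices that is
not simultaneously embeddable. -/
def ConflictCollection {n : ℕ} (𝒢 : Set (SimpleGraph (Fin n))) : Prop :=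
  (∀ G ∈ 𝒢, PlanarEmbeddable G) ∧ ¬ SimultaneouslyEmbeddable 𝒢

/-- The orientation of an ordered triple of points in the plane: the sign of the
determinant of [[1,1,1],[a₁,b₁,c₁],[a₂,b₂,c₂]]. -/
def orient (a b c : Plane) : ℝ :=
  Real.sign (Matrix.det !![(1 : ℝ), 1, 1; a 0, b 0, c 0; a 1, b 1, c 1])

/-- A labelled point tuple is in general position if every triple of points with
distinct indices has nonzero orientation. -/
def GenPos {n : ℕ} (p : Fin n → Plane) : Prop :=
  ∀ i j k : Fin n, i ≠ j → i ≠ k → j ≠ k → orient (p i) (p j) (p k) ≠ 0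

/-- Two labelled point tuples are isomorphic (have the same labelled order type) if
all increasing index triples have the same orientation. -/
def OTIso {n : ℕ} (p q : Fin n → Plane) : Prop :=
  ∀ i j k : Fin n, i < j → j < k → orient (p i) (p j) (p k) = orient (q i) (q j) (q k)

/-- Labelled `n`-point sets in general position. -/
def GPTuple (n : ℕ) := {p : Fin n → Plane // Function.Injective p ∧ GenPos p}

/-- `tS n` is the number `t_s(n,2)` of simple labelled order types: the number of
isomorphism classes of labelled `n`-point sets in general position. -/
def tS (n : ℕ) : ℕ := Nat.card (Quot fun p q : GPTuple n => OTIso p.1 q.1)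


/-- Twice the signed area of the triangle `a b c`. -/
def area (a b c : Plane) : ℝ :=
  (b 0 - a 0) * (c 1 - a 1) - (c 0 - a 0) * (b 1 - a 1)

lemma orient_eq_sign_area (a b c : Plane) : orient a b c = Real.sign (area a b c) := by
  unfold orient area
  rw [Matrix.det_fin_three]
  congr 1
  simp
  ring

lemma area_rotate (a b c : Plane) : area b c a = area a b c := by unfold area; ring

lemma area_swap (a b c : Plane) : area b a c = -area a b c := by unfold area; ring

lemma area_swap_right (a b c : Plane) : area a c b = -area a b c := by unfold area; ring

/-- The segments `a b` and `c d` cross properly. -/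
def Cross (a b c d : Plane) : Prop :=
  area a b c * area a b d < 0 ∧ area c d a * area c d b < 0

lemma Cross.symm {a b c d : Plane} (h : Cross a b c d) : Cross c d a b := ⟨h.2, h.1⟩

lemma Cross.swap_left {a b c d : Plane} (h : Cross a b c d) : Cross b a c d := by
  refine ⟨?_, by rw [mul_comm]; exact h.2⟩
  rw [area_swap a b c, area_swap a b d, neg_mul_neg]
  exact h.1

/-- The point `x` lies strictly inside the triangle `a b c`. -/
def InTri (a b c x : Plane) : Prop :=
  0 < area a b c * area a b x ∧ 0 < area a b c * area b c x ∧ 0 < area a b c * area c a x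

lemma InTri.rotate {a b c x : Plane} (h : InTri a b c x) : InTri b c a x := by
  unfold InTri at *
  rw [area_rotate a b c]
  exact ⟨h.2.1, h.2.2, h.1⟩

lemma InTri.swap {a b c x : Plane} (h : InTri a b c x) : InTri b a c x := by
  unfold InTri at *
  rw [area_swap a b c, area_swap a b x, area_swap c a x, area_swap b c x]
  simp only [neg_mul_neg]
  exact ⟨h.1, h.2.2, h.2.1⟩

lemma area_combination (a b c x y z : Plane) :
    area b c z * area x y a + area c a z * area x y b + area a b z * area x y c
      = area a b c * area x y z := by
  unfold area; ring

lemma exists_opposite_sign {α β γ α' β' γ' A B C : ℝ} (hα : 0 < α) (hβ : 0 < β) (hγ : 0 < γ)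
    (hα' : α' ≠ 0) (hβ' : β' ≠ 0) (hγ' : γ' ≠ 0) (hA : A ≠ 0) (hB : B ≠ 0) (hC : C ≠ 0)
    (h : α * A + β * B + γ * C = 0) (h' : α' * A + β' * B + γ' * C = 0)
    (hn : ¬ (0 < γ' ∧ 0 < α' ∧ 0 < β')) :
    (A * B < 0 ∧ γ' < 0) ∨ (B * C < 0 ∧ α' < 0) ∨ (C * A < 0 ∧ β' < 0) := by
  rcases lt_or_gt_of_ne hA with a | a <;> rcases lt_or_gt_of_ne hB with b | b <;>
  rcases lt_or_gt_of_ne hC with c | c <;> rcases lt_or_gt_of_ne hα' with d | d <;>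
  rcases lt_or_gt_of_ne hβ' with e | e <;> rcases lt_or_gt_of_ne hγ' with f | f <;>
  simp only [mul_neg_iff, a, b, c, d, e, f, a.not_gt, b.not_gt, c.not_gt, d.not_gt, e.not_gt,
    f.not_gt, and_true, and_false, or_true, and_self, or_false, not_true_eq_false,
    not_false_eq_true] at hn ⊢ <;>
  nlinarith

lemma cyclic_sign_change {α β γ A B C : ℝ} (hα : 0 < α) (hβ : 0 < β) (hγ : 0 < γ)
    (hA : A ≠ 0) (hB : B ≠ 0) (hC : C ≠ 0) (h : α * A + β * B + γ * C = 0) :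
    (A < 0 ∧ 0 < B) ∨ (B < 0 ∧ 0 < C) ∨ (C < 0 ∧ 0 < A) := by
  rcases lt_or_gt_of_ne hA with a | a <;> rcases lt_or_gt_of_ne hB with b | b <;>
  rcases lt_or_gt_of_ne hC with c | c <;>
  simp only [a, b, c, a.not_gt, b.not_gt, c.not_gt, and_true, and_false, or_true, and_self,
    or_false] <;>
  nlinarith

lemma inTri_iff_of_pos {a b c x : Plane} (h : 0 < area a b c) :
    InTri a b c x ↔ 0 < area a b x ∧ 0 < area b c x ∧ 0 < area c a x := by
  simp only [InTri, mul_pos_iff_of_pos_left h]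

lemma InTri.area_ne_zero {a b c x : Plane} (h : InTri a b c x) : area a b c ≠ 0 := by
  intro h0
  have := h.1
  simp [h0] at this

lemma area_swap_pos {a b c : Plane} (h : area a b c < 0) : 0 < area b a c := by
  rw [area_swap]; linarith

lemma area_swap_ne {a b c : Plane} (h : area a b c ≠ 0) : area b a c ≠ 0 := by
  rw [area_swap]; exact neg_ne_zero.2 h

lemma exists_cross_of_pos {a b c x w : Plane} (hs : 0 < area a b c)
    (hx : InTri a b c x) (hw : ¬ InTri a b c w)
    (hab : area a b w ≠ 0) (hbc : area b c w ≠ 0) (hca : area c a w ≠ 0)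
    (ha : area x w a ≠ 0) (hb : area x w b ≠ 0) (hc : area x w c ≠ 0) :
    Cross x w a b ∨ Cross x w b c ∨ Cross x w c a := by
  have h1 := area_combination a b c x w x
  have h2 := area_combination a b c x w w
  have e1 : area x w x = 0 := by unfold area; ring
  have e2 : area x w w = 0 := by unfold area; ring
  rw [e1, mul_zero] at h1
  rw [e2, mul_zero] at h2
  rw [inTri_iff_of_pos hs] at hx hw
  obtain ⟨x1, x2, x3⟩ := hx
  rcases exists_opposite_sign x2 x3 x1 hbc hca hab ha hb hc h1 h2 hw with h | h | h
  · exact Or.inl ⟨h.1, mul_neg_of_pos_of_neg x1 h.2⟩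
  · exact Or.inr (Or.inl ⟨h.1, mul_neg_of_pos_of_neg x2 h.2⟩)
  · exact Or.inr (Or.inr ⟨h.1, mul_neg_of_pos_of_neg x3 h.2⟩)

/-- A segment joining an interior point of a triangle to an exterior point crosses a side. -/
lemma InTri.exists_cross {a b c x w : Plane} (hx : InTri a b c x) (hw : ¬ InTri a b c w)
    (hab : area a b w ≠ 0) (hbc : area b c w ≠ 0) (hca : area c a w ≠ 0)
    (ha : area x w a ≠ 0) (hb : area x w b ≠ 0) (hc : area x w c ≠ 0) :
    Cross x w a b ∨ Cross x w b c ∨ Cross x w c a := by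
  rcases lt_or_gt_of_ne hx.area_ne_zero with hs | hs
  · rcases exists_cross_of_pos (area_swap_pos hs) hx.swap (fun h => hw h.swap) (area_swap_ne hab)
      (area_swap_ne hca) (area_swap_ne hbc) hb ha hc with h | h | h
    · exact Or.inl h.symm.swap_left.symm
    · exact Or.inr (Or.inr h.symm.swap_left.symm)
    · exact Or.inr (Or.inl h.symm.swap_left.symm)
  · exact exists_cross_of_pos hs hx hw hab hbc hca ha hb hc

lemma subdivide_of_pos {a b c q x : Plane} (hs : 0 < area a b c) (hq : InTri a b c q)
    (hx : InTri a b c x) (ha : area q x a ≠ 0) (hb : area q x b ≠ 0) (hc : area q x c ≠ 0) :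
    InTri a b q x ∨ InTri b c q x ∨ InTri c a q x := by
  have h1 := area_combination a b c q x q
  have e1 : area q x q = 0 := by unfold area; ring
  rw [e1, mul_zero] at h1
  rw [inTri_iff_of_pos hs] at hq hx
  obtain ⟨q1, q2, q3⟩ := hq
  obtain ⟨x1, x2, x3⟩ := hx
  have key : ∀ u : Plane, area u q x = area q x u ∧ area q u x = -area q x u := fun u =>
    ⟨by rw [← area_rotate], by rw [area_swap_right]⟩
  rw [inTri_iff_of_pos q1, inTri_iff_of_pos q2, inTri_iff_of_pos q3]
  simp only [key, neg_pos, x1, x2, x3, true_and]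
  rcases cyclic_sign_change q2 q3 q1 ha hb hc h1 with h | h | h
  · exact Or.inl h.symm
  · exact Or.inr (Or.inl h.symm)
  · exact Or.inr (Or.inr h.symm)

/-- An interior point of a triangle splits the triangle into three. -/
lemma InTri.subdivide {a b c q x : Plane} (hq : InTri a b c q) (hx : InTri a b c x)
    (ha : area q x a ≠ 0) (hb : area q x b ≠ 0) (hc : area q x c ≠ 0) :
    InTri a b q x ∨ InTri b c q x ∨ InTri c a q x := by
  rcases lt_or_gt_of_ne hq.area_ne_zero with hs | hs
  · rcases subdivide_of_pos (area_swap_pos hs) hq.swap hx.swap hb ha hc with h | h | h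
    · exact Or.inl h.swap
    · exact Or.inr (Or.inr h.swap)
    · exact Or.inr (Or.inl h.swap)
  · exact subdivide_of_pos hs hq hx ha hb hc

lemma inTri_trans_of_pos {a b c q x : Plane} (hs : 0 < area a b c) (hq : InTri a b c q)
    (hx : InTri a b q x) : InTri a b c x := by
  have h1 := area_combination a b q b c x
  have h2 := area_combination a b q c a x
  have e1 : area b c b = 0 := by unfold area; ring
  have e2 : area c a a = 0 := by unfold area; ring
  have e3 : area b c a = area a b c := area_rotate a b c
  have e4 : area c a b = area a b c := by rw [area_rotate, area_rotate]
  rw [inTri_iff_of_pos hs] at hq ⊢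
  obtain ⟨q1, q2, q3⟩ := hq
  rw [inTri_iff_of_pos q1] at hx
  obtain ⟨x1, x2, x3⟩ := hx
  rw [e1, e3] at h1
  rw [e2, e4] at h2
  refine ⟨x1, ?_, ?_⟩
  · refine pos_of_mul_pos_right (a := area a b q) ?_ q1.le
    rw [← h1]; positivity
  · refine pos_of_mul_pos_right (a := area a b q) ?_ q1.le
    rw [← h2]; positivity

lemma InTri.trans {a b c q x : Plane} (hq : InTri a b c q) (hx : InTri a b q x) :
    InTri a b c x := by
  rcases lt_or_gt_of_ne hq.area_ne_zero with hs | hs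
  · exact (inTri_trans_of_pos (area_swap_pos hs) hq.swap hx.swap).swap
  · exact inTri_trans_of_pos hs hq hx

lemma convex_or_nested_of_pos {a b c q : Plane} (hs : 0 < area a b c) (hq : ¬ InTri a b c q)
    (hab : area a b q ≠ 0) (hbc : area b c q ≠ 0) (hca : area c a q ≠ 0)
    (h1 : ¬ Cross a b c q) (h2 : ¬ Cross b c a q) (h3 : ¬ Cross c a b q) :
    InTri a b q c ∨ InTri b c q a ∨ InTri c a q b := by
  have e1 : area b c a = area a b c := area_rotate a b c
  have e2 : area c a b = area a b c := by rw [area_rotate, area_rotate]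
  have key : ∀ u v : Plane, area u q v = -area u v q ∧ area q u v = area u v q := fun u v =>
    ⟨area_swap_right _ _ _, by rw [← area_rotate]⟩
  have s1 : area b a q = -area a b q := area_swap _ _ _
  have s2 : area c b q = -area b c q := area_swap _ _ _
  have s3 : area a c q = -area c a q := area_swap _ _ _
  rw [inTri_iff_of_pos hs] at hq
  simp only [Cross, InTri, key, s1, s2, s3, e1, e2] at h1 h2 h3 ⊢
  clear key s1 s2 s3 e1 e2
  generalize area a b c = s at *
  generalize area a b q = γ at *
  generalize area b c q = α at *
  generalize area c a q = β at *
  rcases lt_or_gt_of_ne hab with d | d <;> rcases lt_or_gt_of_ne hbc with e | e <;>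
  rcases lt_or_gt_of_ne hca with f | f <;>
  simp only [neg_neg, mul_neg_iff, mul_pos_iff, neg_pos, neg_lt_zero, hs, hs.not_gt, d, e, f,
    d.not_gt, e.not_gt, f.not_gt, and_true, and_false, or_true, and_self, or_false,
    not_true_eq_false, not_false_eq_true] at h1 h2 h3 hq ⊢

/-- Among four points in general position spanning a crossing-free complete graph,
one lies inside the triangle formed by the others. -/
lemma convex_or_nested {a b c q : Plane} (hs : area a b c ≠ 0) (hq : ¬ InTri a b c q)
    (hab : area a b q ≠ 0) (hbc : area b c q ≠ 0) (hca : area c a q ≠ 0)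
    (h1 : ¬ Cross a b c q) (h2 : ¬ Cross b c a q) (h3 : ¬ Cross c a b q) :
    InTri a b q c ∨ InTri b c q a ∨ InTri c a q b := by
  rcases lt_or_gt_of_ne hs with hs | hs
  · rcases convex_or_nested_of_pos (area_swap_pos hs) (fun h => hq h.swap) (area_swap_ne hab)
      (area_swap_ne hca) (area_swap_ne hbc) (fun h => h1 h.swap_left)
      (fun h => h3 h.swap_left) (fun h => h2 h.swap_left) with h | h | h
    · exact Or.inl h.swap
    · exact Or.inr (Or.inr h.swap)
    · exact Or.inr (Or.inl h.swap)
  · exact convex_or_nested_of_pos hs hq hab hbc hca h1 h2 h3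

/-- The triangles `b c q` and `a b c` lie on different sides of `b c` when `c` is inside
`a b q`. -/
lemma InTri.not_inTri_adjacent {a b c q w : Plane} (hc : InTri a b q c)
    (hw : 0 < area b c a * area b c w) : ¬ InTri b c q w := by
  intro h
  have h1 := hc.1
  have h2 := hc.2.1
  have h3 := h.1
  rw [area_rotate a b c] at hw
  rw [area_swap_right b c q] at h2
  have : 0 < (area a b q * area a b c) * (area a b c * area b c w) := mul_pos h1 hw
  have : 0 < (area a b q * -area b c q) * (area b c q * area b c w) := mul_pos h2 h3
  nlinarith [mul_self_nonneg (area a b c), mul_self_nonneg (area b c q), mul_pos hw h3,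
    mul_pos h1 h2]

/-- The faces of the triangulation obtained from `K₄` on `{0, 1, 2, 3}` by stacking the vertices
`4, 5, …` successively into the faces listed (last one first). -/
def stackFaces : List (Finset ℕ) → Finset (Finset ℕ)
  | [] => (Finset.range 4).image (Finset.range 4).erase
  | f :: L => (stackFaces L).erase f ∪ f.image fun c => insert (L.length + 4) (f.erase c)

/-- The adjacency relation of the stacked triangulation. -/
def stackAdj : List (Finset ℕ) → ℕ → ℕ → Prop
  | [], u, v => u < 4 ∧ v < 4 ∧ u ≠ v
  | f :: L, u, v => stackAdj L u v ∨ (u = L.length + 4 ∧ v ∈ f) ∨ (v = L.length + 4 ∧ u ∈ f)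

/-- Every listed triple is a face at the time it is stacked. -/
def StackValid : List (Finset ℕ) → Prop
  | [] => True
  | f :: L => f ∈ stackFaces L ∧ StackValid L

lemma mem_stackFaces_nil {g : Finset ℕ} :
    g ∈ stackFaces [] ↔ ∃ x < 4, (Finset.range 4).erase x = g := by
  simp [stackFaces]

lemma mem_stackFaces_cons {f g : Finset ℕ} {L : List (Finset ℕ)} :
    g ∈ stackFaces (f :: L) ↔
      (g ≠ f ∧ g ∈ stackFaces L) ∨ ∃ c ∈ f, insert (L.length + 4) (f.erase c) = g := by
  simp [stackFaces]

lemma lt_of_mem_stackFaces {L : List (Finset ℕ)} (hL : StackValid L) {g : Finset ℕ}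
    (hg : g ∈ stackFaces L) {w : ℕ} (hw : w ∈ g) : w < L.length + 4 := by
  induction L generalizing g w with
  | nil =>
    obtain ⟨x, -, rfl⟩ := mem_stackFaces_nil.1 hg
    simpa using Finset.mem_of_mem_erase hw
  | cons f L ih =>
    rw [List.length_cons]
    rcases mem_stackFaces_cons.1 hg with ⟨-, h⟩ | ⟨c, hc, rfl⟩
    · have := ih hL.2 h hw
      omega
    · rcases Finset.mem_insert.1 hw with rfl | h
      · omega
      · have := ih hL.2 hL.1 (Finset.mem_of_mem_erase h)
        omega

lemma card_of_mem_stackFaces {L : List (Finset ℕ)} (hL : StackValid L) {g : Finset ℕ}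
    (hg : g ∈ stackFaces L) : g.card = 3 := by
  induction L generalizing g with
  | nil =>
    obtain ⟨x, hx, rfl⟩ := mem_stackFaces_nil.1 hg
    simp [Finset.card_erase_of_mem (Finset.mem_range.2 hx)]
  | cons f L ih =>
    rcases mem_stackFaces_cons.1 hg with ⟨-, h⟩ | ⟨c, hc, rfl⟩
    · exact ih hL.2 h
    · rw [Finset.card_insert_of_notMem, Finset.card_erase_of_mem hc, ih hL.2 hL.1]
      intro h
      exact lt_irrefl _ (lt_of_mem_stackFaces hL.2 hL.1 (Finset.mem_of_mem_erase h))

lemma stackAdj_of_mem {L : List (Finset ℕ)} (hL : StackValid L) {g : Finset ℕ}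
    (hg : g ∈ stackFaces L) {a b : ℕ} (ha : a ∈ g) (hb : b ∈ g) (hab : a ≠ b) :
    stackAdj L a b := by
  induction L generalizing g with
  | nil =>
    exact ⟨by simpa using lt_of_mem_stackFaces hL hg ha,
      by simpa using lt_of_mem_stackFaces hL hg hb, hab⟩
  | cons f L ih =>
    rcases mem_stackFaces_cons.1 hg with ⟨-, h⟩ | ⟨c, hc, rfl⟩
    · exact Or.inl (ih hL.2 h ha hb)
    · rcases Finset.mem_insert.1 ha with rfl | ha
      · rcases Finset.mem_insert.1 hb with rfl | hb
        · exact absurd rfl hab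
        · exact Or.inr (Or.inl ⟨rfl, Finset.mem_of_mem_erase hb⟩)
      · rcases Finset.mem_insert.1 hb with rfl | hb
        · exact Or.inr (Or.inr ⟨rfl, Finset.mem_of_mem_erase ha⟩)
        · exact Or.inl (ih hL.2 hL.1 (Finset.mem_of_mem_erase ha) (Finset.mem_of_mem_erase hb))

lemma stackAdj.symm {L : List (Finset ℕ)} {u v : ℕ} (h : stackAdj L u v) : stackAdj L v u := by
  induction L with
  | nil => exact ⟨h.2.1, h.1, h.2.2.symm⟩
  | cons f L ih =>
    rcases h with h | h | h
    · exact Or.inl (ih h)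
    · exact Or.inr (Or.inr h)
    · exact Or.inr (Or.inl h)

lemma stackAdj.lt {L : List (Finset ℕ)} (hL : StackValid L) {u v : ℕ} (h : stackAdj L u v) :
    u < L.length + 4 := by
  induction L with
  | nil => simpa using h.1
  | cons f L ih =>
    rw [List.length_cons]
    rcases h with h | h | h
    · have := ih hL.2 h
      omega
    · omega
    · have := lt_of_mem_stackFaces hL.2 hL.1 h.2
      omega

lemma stackAdj.ne {L : List (Finset ℕ)} (hL : StackValid L) {u v : ℕ} (h : stackAdj L u v) :
    u ≠ v := by
  induction L with
  | nil => exact h.2.2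
  | cons f L ih =>
    rcases h with h | ⟨rfl, h⟩ | ⟨rfl, h⟩
    · exact ih hL.2 h
    · exact (lt_of_mem_stackFaces hL.2 hL.1 h).ne'
    · exact (lt_of_mem_stackFaces hL.2 hL.1 h).ne

lemma card_stackFaces {L : List (Finset ℕ)} (hL : StackValid L) :
    (stackFaces L).card = 2 * L.length + 4 := by
  induction L with
  | nil => decide
  | cons f L ih =>
    have hnew : ∀ c, L.length + 4 ∉ f.erase c := fun c h =>
      lt_irrefl _ (lt_of_mem_stackFaces hL.2 hL.1 (Finset.mem_of_mem_erase h))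
    rw [stackFaces, Finset.card_union_of_disjoint, Finset.card_erase_of_mem hL.1, ih hL.2,
      Finset.card_image_of_injOn, card_of_mem_stackFaces hL.2 hL.1, List.length_cons]
    · omega
    · intro c hc d hd h
      have h' : f.erase c = f.erase d := by
        have := congrArg (fun s => s.erase (L.length + 4)) h
        simpa only [Finset.erase_insert (hnew _)] using this
      by_contra hcd
      exact Finset.notMem_erase c f (h' ▸ Finset.mem_erase.2 ⟨hcd, hc⟩)
    · rw [Finset.disjoint_left]
      intro g hg hg'
      obtain ⟨c, -, rfl⟩ := Finset.mem_image.1 hg'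
      exact lt_irrefl _ (lt_of_mem_stackFaces hL.2 (Finset.mem_of_mem_erase hg)
        (Finset.mem_insert_self _ _))

lemma exists_triple {f : Finset ℕ} (hf : f.card = 3) {c : ℕ} (hc : c ∈ f) :
    ∃ a b, a ≠ b ∧ b ≠ c ∧ a ≠ c ∧ f = {a, b, c} ∧ f.erase c = {a, b} := by
  have h2 : (f.erase c).card = 2 := by rw [Finset.card_erase_of_mem hc, hf]
  obtain ⟨a, b, hab, h⟩ := Finset.card_eq_two.1 h2
  have ha : a ∈ f.erase c := by simp [h]
  have hb : b ∈ f.erase c := by simp [h]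
  refine ⟨a, b, hab, (Finset.mem_erase.1 hb).1, (Finset.mem_erase.1 ha).1, ?_, h⟩
  rw [← Finset.insert_erase hc, h]
  ext x
  simp only [Finset.mem_insert, Finset.mem_singleton]
  tauto

/-- The point `p w` lies strictly inside the triangle spanned by the face `f`. -/
def InFace (p : ℕ → Plane) (f : Finset ℕ) (w : ℕ) : Prop :=
  ∀ a ∈ f, ∀ b ∈ f, ∀ c ∈ f, a ≠ b → b ≠ c → a ≠ c → InTri (p a) (p b) (p c) (p w)

lemma inFace_triple {p : ℕ → Plane} {a b c w : ℕ} (hab : a ≠ b) (hbc : b ≠ c) (hac : a ≠ c) :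
    InFace p {a, b, c} w ↔ InTri (p a) (p b) (p c) (p w) := by
  constructor
  · intro h
    exact h a (by simp) b (by simp) c (by simp) hab hbc hac
  · intro h x hx y hy z hz hxy hyz hxz
    simp only [Finset.mem_insert, Finset.mem_singleton] at hx hy hz
    rcases hx with rfl | rfl | rfl <;> rcases hy with rfl | rfl | rfl <;>
    rcases hz with rfl | rfl | rfl <;> first
      | exact absurd rfl hxy
      | exact absurd rfl hyz
      | exact absurd rfl hxz
      | exact h
      | exact h.rotate
      | exact h.rotate.rotate
      | exact h.swap
      | exact h.swap.rotate
      | exact h.swap.rotate.rotate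

lemma not_inFace_of_mem {p : ℕ → Plane} {f : Finset ℕ} (hf : f.card = 3) {w : ℕ} (hw : w ∈ f) :
    ¬ InFace p f w := by
  obtain ⟨a, b, hab, hbc, hac, rfl, -⟩ := exists_triple hf hw
  rw [inFace_triple hab hbc hac]
  intro h
  have h2 := h.2.1
  have : area (p b) (p w) (p w) = 0 := by unfold area; ring
  rw [this, mul_zero] at h2
  exact lt_irrefl _ h2

/-- The points `p 0, …, p (n - 1)` are in general position. -/
def GenericBelow (p : ℕ → Plane) (n : ℕ) : Prop :=
  ∀ i < n, ∀ j < n, ∀ k < n, i ≠ j → j ≠ k → i ≠ k → area (p i) (p j) (p k) ≠ 0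

/-- No two edges of the stacked triangulation cross properly. -/
def CrossFree (L : List (Finset ℕ)) (p : ℕ → Plane) : Prop :=
  ∀ u v x y, stackAdj L u v → stackAdj L x y → ¬ Cross (p u) (p v) (p x) (p y)

lemma CrossFree.tail {f : Finset ℕ} {L : List (Finset ℕ)} {p : ℕ → Plane}
    (h : CrossFree (f :: L) p) : CrossFree L p :=
  fun u v x y huv hxy => h u v x y (Or.inl huv) (Or.inl hxy)

/-- An edge does not join a point inside a face to a point outside of it. -/
lemma CrossFree.mem_of_inFace {L : List (Finset ℕ)} {p : ℕ → Plane} (h : CrossFree L p) {n : ℕ}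
    (hp : GenericBelow p n) {g : Finset ℕ} (hg3 : g.card = 3) (hgn : ∀ a ∈ g, a < n)
    (hg : ∀ a ∈ g, ∀ b ∈ g, a ≠ b → stackAdj L a b) {x w : ℕ} (hx : x < n) (hw : w < n)
    (hxw : x ≠ w) (hadj : stackAdj L x w) (hxg : InFace p g x) (hwg : ¬ InFace p g w) : w ∈ g := by
  by_contra hmem
  have hxmem : x ∉ g := fun hm => not_inFace_of_mem hg3 hm hxg
  obtain ⟨c, hc⟩ : g.Nonempty := Finset.card_pos.1 (by omega)
  obtain ⟨a, b, hab, hbc, hac, rfl, -⟩ := exists_triple hg3 hc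
  rw [inFace_triple hab hbc hac] at hxg hwg
  simp only [Finset.mem_insert, Finset.mem_singleton, not_or, forall_eq_or_imp, forall_eq]
    at hmem hxmem hgn
  obtain ⟨ha, hb, hc⟩ := hgn
  obtain ⟨w1, w2, w3⟩ := hmem
  obtain ⟨x1, x2, x3⟩ := hxmem
  have hadj' := fun u hu v hv huv => h x w u v hadj (hg u hu v hv huv)
  rcases hxg.exists_cross hwg (hp a ha b hb w hw hab (Ne.symm w2) (Ne.symm w1))
    (hp b hb c hc w hw hbc (Ne.symm w3) (Ne.symm w2))
    (hp c hc a ha w hw hac.symm (Ne.symm w1) (Ne.symm w3))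
    (hp x hx w hw a ha hxw w1 x1) (hp x hx w hw b hb hxw w2 x2)
    (hp x hx w hw c hc hxw w3 x3) with h | h | h
  · exact hadj' a (by simp) b (by simp) hab h
  · exact hadj' b (by simp) c (by simp) hbc h
  · exact hadj' c (by simp) a (by simp) hac.symm h

/-- The face `o` is the outer face of the drawing of the stacked triangulation: it contains all
other vertices, the other faces are empty, and they cover all later points inside `o`. -/
structure IsOuterFace (L : List (Finset ℕ)) (p : ℕ → Plane) (n : ℕ) (o : Finset ℕ) : Prop where
  mem : o ∈ stackFaces L
  outer : ∀ w < L.length + 4, w ∉ o → InFace p o w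
  empty : ∀ g ∈ stackFaces L, g ≠ o → ∀ w < L.length + 4, ¬ InFace p g w
  cover : ∀ x, L.length + 4 ≤ x → x < n → InFace p o x →
    ∃ g ∈ stackFaces L, g ≠ o ∧ InFace p g x

lemma eq_of_subset_face {L : List (Finset ℕ)} (hL : StackValid L) {f g : Finset ℕ}
    (hf : f ∈ stackFaces L) (hg : g ∈ stackFaces L) (h : f ⊆ g) : f = g :=
  Finset.eq_of_subset_of_card_le h
    (by rw [card_of_mem_stackFaces hL hf, card_of_mem_stackFaces hL hg])

/-- A new vertex inside an inner face is stacked into that face. -/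
lemma IsOuterFace.eq_of_inFace {L : List (Finset ℕ)} {p : ℕ → Plane} {n : ℕ} {o f g : Finset ℕ}
    (ho : IsOuterFace L p n o) (hL : StackValid L) (hf : f ∈ stackFaces L)
    (hp : GenericBelow p n) (hn : L.length + 4 < n) (hc : CrossFree (f :: L) p)
    (hg : g ∈ stackFaces L) (hgo : g ≠ o) (hin : InFace p g (L.length + 4)) : f = g := by
  refine eq_of_subset_face hL hf hg fun w hw => ?_
  have hwl := lt_of_mem_stackFaces hL hf hw
  exact hc.mem_of_inFace hp (card_of_mem_stackFaces hL hg)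
    (fun a ha => (lt_of_mem_stackFaces hL hg ha).trans hn)
    (fun a ha b hb hab => Or.inl (stackAdj_of_mem hL hg ha hb hab)) hn (hwl.trans hn) hwl.ne'
    (Or.inr (Or.inl ⟨rfl, hw⟩)) hin (ho.empty g hg hgo w hwl)

/-- A new vertex outside the outer face is stacked into the outer face. -/
lemma IsOuterFace.eq_of_not_inFace {L : List (Finset ℕ)} {p : ℕ → Plane} {n : ℕ} {o f : Finset ℕ}
    (ho : IsOuterFace L p n o) (hL : StackValid L) (hf : f ∈ stackFaces L)
    (hp : GenericBelow p n) (hn : L.length + 4 < n) (hc : CrossFree (f :: L) p)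
    (hin : ¬ InFace p o (L.length + 4)) : f = o := by
  refine eq_of_subset_face hL hf ho.mem fun w hw => ?_
  have hwl := lt_of_mem_stackFaces hL hf hw
  by_contra hwo
  have hcard := card_of_mem_stackFaces hL ho.mem
  have := hc.mem_of_inFace hp hcard
    (fun a ha => (lt_of_mem_stackFaces hL ho.mem ha).trans hn)
    (fun a ha b hb hab => Or.inl (stackAdj_of_mem hL ho.mem ha hb hab)) (hwl.trans hn) hn hwl.ne
    (Or.inr (Or.inr ⟨rfl, hw⟩)) (ho.outer w hwl hwo) hin
  exact lt_irrefl _ (lt_of_mem_stackFaces hL ho.mem this)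

lemma insert_pair_eq (N a b : ℕ) : (insert N {a, b} : Finset ℕ) = {a, b, N} := by
  ext x
  simp only [Finset.mem_insert, Finset.mem_singleton]
  tauto

/-- Every point inside a face lies inside one of the faces obtained by stacking into it. -/
lemma InFace.subdivide {p : ℕ → Plane} {n : ℕ} (hp : GenericBelow p n) {f : Finset ℕ}
    (hf : f.card = 3) (hfn : ∀ a ∈ f, a < n) {q x : ℕ} (hq : q < n) (hx : x < n) (hqx : q ≠ x)
    (hqf : InFace p f q) (hxf : InFace p f x) :
    ∃ c ∈ f, InFace p (insert q (f.erase c)) x := by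
  have hqm : q ∉ f := fun hm => not_inFace_of_mem hf hm hqf
  have hxm : x ∉ f := fun hm => not_inFace_of_mem hf hm hxf
  obtain ⟨c, hc⟩ : f.Nonempty := Finset.card_pos.1 (by omega)
  obtain ⟨a, b, hab, hbc, hac, rfl, he⟩ := exists_triple hf hc
  rw [inFace_triple hab hbc hac] at hqf hxf
  simp only [Finset.mem_insert, Finset.mem_singleton, not_or, forall_eq_or_imp, forall_eq]
    at hqm hxm hfn
  obtain ⟨q1, q2, q3⟩ := hqm
  obtain ⟨x1, x2, x3⟩ := hxm
  obtain ⟨ha, hb, hc⟩ := hfn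
  rcases hqf.subdivide hxf (hp q hq x hx a ha hqx x1 q1) (hp q hq x hx b hb hqx x2 q2)
    (hp q hq x hx c hc hqx x3 q3) with h | h | h
  · refine ⟨c, by simp, ?_⟩
    have : insert q (({a, b, c} : Finset ℕ).erase c) = {a, b, q} := by rw [he, insert_pair_eq]
    rw [this, inFace_triple hab (Ne.symm q2) (Ne.symm q1)]
    exact h
  · refine ⟨a, by simp, ?_⟩
    have : insert q (({a, b, c} : Finset ℕ).erase a) = {b, c, q} := by
      rw [Finset.erase_insert (by simp [hab, hac]), insert_pair_eq]
    rw [this, inFace_triple hbc (Ne.symm q3) (Ne.symm q2)]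
    exact h
  · refine ⟨b, by simp, ?_⟩
    have : insert q (({a, b, c} : Finset ℕ).erase b) = {c, a, q} := by
      rw [← insert_pair_eq q c a]
      congr 1
      ext y
      simp only [Finset.mem_erase, Finset.mem_insert, Finset.mem_singleton]
      grind
    rw [this, inFace_triple hac.symm (Ne.symm q1) (Ne.symm q3)]
    exact h

lemma InFace.trans {p : ℕ → Plane} {f : Finset ℕ} (hf : f.card = 3) {q x c : ℕ} (hc : c ∈ f)
    (hqf : InFace p f q) (hx : InFace p (insert q (f.erase c)) x) : InFace p f x := by
  have hqm : q ∉ f := fun hm => not_inFace_of_mem hf hm hqf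
  obtain ⟨a, b, hab, hbc, hac, rfl, he⟩ := exists_triple hf hc
  simp only [Finset.mem_insert, Finset.mem_singleton, not_or] at hqm
  rw [he, insert_pair_eq, inFace_triple hab (Ne.symm hqm.2.1) (Ne.symm hqm.1)] at hx
  rw [inFace_triple hab hbc hac] at hqf ⊢
  exact hqf.trans hx

/-- Exactly one of four points spanning a crossing-free complete graph is inside the others. -/
lemma not_inFace_exchange {p : ℕ → Plane} {f : Finset ℕ} (hf : f.card = 3) {q c : ℕ} (hc : c ∈ f)
    (hqf : InFace p f q) : ¬ InFace p (insert q (f.erase c)) c :=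
  fun h => not_inFace_of_mem hf hc (InFace.trans hf hc hqf h)

lemma isOuterFace_nil {p : ℕ → Plane} {n : ℕ} (hp : GenericBelow p n) (hn : 4 ≤ n)
    (hc : CrossFree [] p) : ∃ o, IsOuterFace [] p n o := by
  have hcr : ∀ u < 4, ∀ v < 4, ∀ x < 4, ∀ y < 4, u ≠ v → x ≠ y →
      ¬ Cross (p u) (p v) (p x) (p y) := fun u hu v hv x hx y hy huv hxy =>
    hc u v x y ⟨hu, hv, huv⟩ ⟨hx, hy, hxy⟩
  have hg : ∀ i < 4, ∀ j < 4, ∀ k < 4, i ≠ j → j ≠ k → i ≠ k →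
      area (p i) (p j) (p k) ≠ 0 := fun i hi j hj k hk =>
    hp i (by omega) j (by omega) k (by omega)
  obtain ⟨q, hq, hin⟩ : ∃ q < 4, InFace p ((Finset.range 4).erase q) q := by
    by_cases h : InTri (p 0) (p 1) (p 2) (p 3)
    · refine ⟨3, by norm_num, ?_⟩
      rw [show (Finset.range 4).erase 3 = {0, 1, 2} by decide]
      exact (inFace_triple (by decide) (by decide) (by decide)).2 h
    · rcases convex_or_nested (hg 0 (by decide) 1 (by decide) 2 (by decide) (by decide)
        (by decide) (by decide)) h
        (hg 0 (by decide) 1 (by decide) 3 (by decide) (by decide) (by decide) (by decide))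
        (hg 1 (by decide) 2 (by decide) 3 (by decide) (by decide) (by decide) (by decide))
        (hg 2 (by decide) 0 (by decide) 3 (by decide) (by decide) (by decide) (by decide))
        (hcr _ (by decide) _ (by decide) _ (by decide) _ (by decide) (by decide) (by decide))
        (hcr _ (by decide) _ (by decide) _ (by decide) _ (by decide) (by decide) (by decide))
        (hcr _ (by decide) _ (by decide) _ (by decide) _ (by decide) (by decide) (by decide))
        with h | h | h
      · refine ⟨2, by norm_num, ?_⟩
        rw [show (Finset.range 4).erase 2 = {0, 1, 3} by decide]
        exact (inFace_triple (by decide) (by decide) (by decide)).2 h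
      · refine ⟨0, by norm_num, ?_⟩
        rw [show (Finset.range 4).erase 0 = {1, 2, 3} by decide]
        exact (inFace_triple (by decide) (by decide) (by decide)).2 h
      · refine ⟨1, by norm_num, ?_⟩
        rw [show (Finset.range 4).erase 1 = {2, 0, 3} by decide]
        exact (inFace_triple (by decide) (by decide) (by decide)).2 h
  have hmem : (Finset.range 4).erase q ∈ stackFaces [] := mem_stackFaces_nil.2 ⟨q, hq, rfl⟩
  have hcard := card_of_mem_stackFaces (L := []) trivial hmem
  have hswap : ∀ x < 4, x ≠ q →
      insert q (((Finset.range 4).erase q).erase x) = (Finset.range 4).erase x := by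
    intro x hx hxq
    ext y
    simp only [Finset.mem_insert, Finset.mem_erase, Finset.mem_range]
    grind
  refine ⟨(Finset.range 4).erase q, hmem, ?_, ?_, ?_⟩
  · intro w hw hwo
    have : w = q := by
      by_contra hne
      exact hwo (Finset.mem_erase.2 ⟨hne, Finset.mem_range.2 (by simpa using hw)⟩)
    exact this ▸ hin
  · intro g hgm hgo w hw hwin
    obtain ⟨x, hx, rfl⟩ := mem_stackFaces_nil.1 hgm
    have hxq : x ≠ q := fun h => hgo (h ▸ rfl)
    by_cases hwx : w = x
    · subst hwx
      rw [← hswap w hx hxq] at hwin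
      exact not_inFace_exchange hcard (Finset.mem_erase.2 ⟨hxq, Finset.mem_range.2 hx⟩) hin hwin
    · exact not_inFace_of_mem (card_of_mem_stackFaces (L := []) trivial hgm)
        (Finset.mem_erase.2 ⟨hwx, Finset.mem_range.2 (by simpa using hw)⟩) hwin
  · intro x hx hxn hxin
    simp only [List.length_nil, zero_add] at hx
    obtain ⟨c, hcm, hcin⟩ := InFace.subdivide hp hcard
      (fun a ha => by have := Finset.mem_range.1 (Finset.mem_of_mem_erase ha); omega)
      (by omega) hxn (by omega) hin hxin
    obtain ⟨hcq, hc4⟩ := Finset.mem_erase.1 hcm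
    rw [hswap c (Finset.mem_range.1 hc4) hcq] at hcin
    refine ⟨_, mem_stackFaces_nil.2 ⟨c, Finset.mem_range.1 hc4, rfl⟩, ?_, hcin⟩
    intro h
    exact Finset.notMem_erase c (Finset.range 4) (h ▸ hcm)

lemma IsOuterFace.stack_inner {L : List (Finset ℕ)} {p : ℕ → Plane} {n : ℕ} {o f : Finset ℕ}
    (ho : IsOuterFace L p n o) (hL : StackValid L) (hf : f ∈ stackFaces L)
    (hp : GenericBelow p n) (hn : L.length + 4 < n) (hc : CrossFree (f :: L) p)
    (hin : InFace p o (L.length + 4)) : IsOuterFace (f :: L) p n o := by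
  obtain ⟨g, hg, hgo, hgin⟩ := ho.cover _ le_rfl hn hin
  obtain rfl := ho.eq_of_inFace hL hf hp hn hc hg hgo hgin
  have hf3 := card_of_mem_stackFaces hL hf
  refine ⟨mem_stackFaces_cons.2 (Or.inl ⟨hgo.symm, ho.mem⟩), ?_, ?_, ?_⟩
  · intro w hw hwo
    rcases Nat.lt_succ_iff_lt_or_eq.1
      (show w < (L.length + 4).succ by simpa [add_right_comm] using hw) with h | rfl
    · exact ho.outer w h hwo
    · exact hin
  · intro g hg hgo' w hw hwin
    have hw' := Nat.lt_succ_iff_lt_or_eq.1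
      (show w < (L.length + 4).succ by simpa [add_right_comm] using hw)
    rcases mem_stackFaces_cons.1 hg with ⟨hgf, hg⟩ | ⟨c, hcf, rfl⟩
    · rcases hw' with h | rfl
      · exact ho.empty g hg hgo' w h hwin
      · exact hgf (ho.eq_of_inFace hL hf hp hn hc hg hgo' hwin).symm
    · rcases hw' with h | rfl
      · exact ho.empty f hf hgo w h (InFace.trans hf3 hcf hgin hwin)
      · exact not_inFace_of_mem (card_of_mem_stackFaces (L := f :: L) ⟨hf, hL⟩ hg)
          (Finset.mem_insert_self _ _) hwin
  · intro x hx hxn hxin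
    have hx' : L.length + 4 < x := by simp only [List.length_cons] at hx; omega
    obtain ⟨g, hg, hgo', hgx⟩ := ho.cover x hx'.le hxn hxin
    by_cases hgf : g = f
    · subst hgf
      obtain ⟨c, hcf, hcx⟩ := InFace.subdivide hp hf3
        (fun a ha => (lt_of_mem_stackFaces hL hf ha).trans hn) hn hxn hx'.ne hgin hgx
      refine ⟨_, mem_stackFaces_cons.2 (Or.inr ⟨c, hcf, rfl⟩), ?_, hcx⟩
      intro h
      exact lt_irrefl _ (lt_of_mem_stackFaces hL ho.mem (h ▸ Finset.mem_insert_self _ _))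
    · exact ⟨g, mem_stackFaces_cons.2 (Or.inl ⟨hgf, hg⟩), hgo', hgx⟩

lemma IsOuterFace.stack_outer {L : List (Finset ℕ)} {p : ℕ → Plane} {n : ℕ} {o f : Finset ℕ}
    (ho : IsOuterFace L p n o) (hL : StackValid L) (hf : f ∈ stackFaces L)
    (hp : GenericBelow p n) (hn : L.length + 4 < n) (hc : CrossFree (f :: L) p)
    (hout : ¬ InFace p o (L.length + 4)) : ∃ o', IsOuterFace (f :: L) p n o' := by
  obtain rfl := ho.eq_of_not_inFace hL hf hp hn hc hout
  have hf3 := card_of_mem_stackFaces hL hf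
  have hfN : L.length + 4 ∉ f := fun h => lt_irrefl _ (lt_of_mem_stackFaces hL hf h)
  have hV : StackValid (f :: L) := ⟨hf, hL⟩
  have hadjN : ∀ a ∈ f, stackAdj (f :: L) a (L.length + 4) := fun a ha => Or.inr (Or.inr ⟨rfl, ha⟩)
  have hadj : ∀ a ∈ f, ∀ b ∈ f, a ≠ b → stackAdj (f :: L) a b := fun a ha b hb hab =>
    Or.inl (stackAdj_of_mem hL hf ha hb hab)
  have hlt : ∀ a ∈ f, a < n := fun a ha => (lt_of_mem_stackFaces hL hf ha).trans hn
  have hneN : ∀ a ∈ f, a ≠ L.length + 4 := fun a ha => (lt_of_mem_stackFaces hL hf ha).ne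
  -- some vertex `c` of the old outer face lies inside the new one
  obtain ⟨c, hcf, hcin⟩ : ∃ c ∈ f, InFace p (insert (L.length + 4) (f.erase c)) c := by
    obtain ⟨c, hcf⟩ : f.Nonempty := Finset.card_pos.1 (by omega)
    obtain ⟨a, b, hab, hbc, hac, hfe, he⟩ := exists_triple hf3 hcf
    have ha : a ∈ f := by simp [hfe]
    have hb : b ∈ f := by simp [hfe]
    have hea : f.erase a = {b, c} := by
      rw [hfe, Finset.erase_insert (by simp [hab, hac])]
    have heb : f.erase b = {c, a} := by
      rw [hfe]
      ext y
      simp only [Finset.mem_erase, Finset.mem_insert, Finset.mem_singleton]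
      grind
    rw [hfe, inFace_triple hab hbc hac] at hout
    rcases convex_or_nested (hp a (hlt a ha) b (hlt b hb) c (hlt c hcf) hab hbc hac) hout
      (hp a (hlt a ha) b (hlt b hb) _ hn hab (hneN b hb) (hneN a ha))
      (hp b (hlt b hb) c (hlt c hcf) _ hn hbc (hneN c hcf) (hneN b hb))
      (hp c (hlt c hcf) a (hlt a ha) _ hn hac.symm (hneN a ha) (hneN c hcf))
      (hc _ _ _ _ (hadj a ha b hb hab) (hadjN c hcf))
      (hc _ _ _ _ (hadj b hb c hcf hbc) (hadjN a ha))
      (hc _ _ _ _ (hadj c hcf a ha hac.symm) (hadjN b hb)) with h | h | h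
    · exact ⟨c, hcf, by rwa [he, insert_pair_eq, inFace_triple hab (hneN b hb) (hneN a ha)]⟩
    · exact ⟨a, ha, by rwa [hea, insert_pair_eq, inFace_triple hbc (hneN c hcf) (hneN b hb)]⟩
    · exact ⟨b, hb, by rwa [heb, insert_pair_eq, inFace_triple hac.symm (hneN a ha) (hneN c hcf)]⟩
  have hmem' : insert (L.length + 4) (f.erase c) ∈ stackFaces (f :: L) :=
    mem_stackFaces_cons.2 (Or.inr ⟨c, hcf, rfl⟩)
  have hcard' := card_of_mem_stackFaces hV hmem'
  have hback : insert c ((insert (L.length + 4) (f.erase c)).erase (L.length + 4)) = f := by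
    rw [Finset.erase_insert (fun h => hfN (Finset.mem_of_mem_erase h)), Finset.insert_erase hcf]
  have hswap : ∀ x ∈ f, x ≠ c →
      insert c ((insert (L.length + 4) (f.erase c)).erase x)
        = insert (L.length + 4) (f.erase x) := by
    intro x hx hxc
    have := hneN x hx
    ext y
    simp only [Finset.mem_insert, Finset.mem_erase]
    grind
  refine ⟨_, hmem', ?_, ?_, ?_⟩
  · intro w hw hwo
    simp only [Finset.mem_insert, Finset.mem_erase, not_or, not_and] at hwo
    by_cases hwc : w = c
    · exact hwc ▸ hcin
    · have hwf : InFace p f w := ho.outer w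
        (by have := hwo.1; simp only [List.length_cons] at hw; omega) (hwo.2 hwc)
      rw [← hback] at hwf
      exact InFace.trans hcard' (Finset.mem_insert_self _ _) hcin hwf
  · intro g hg hgo w hw hwin
    have hw' := Nat.lt_succ_iff_lt_or_eq.1
      (show w < (L.length + 4).succ by simpa [add_right_comm] using hw)
    rcases mem_stackFaces_cons.1 hg with ⟨hgf, hg⟩ | ⟨x, hxf, rfl⟩
    · rcases hw' with h | rfl
      · exact ho.empty g hg hgf w h hwin
      · exact hgf (ho.eq_of_inFace hL hf hp hn hc hg hgf hwin).symm
    · rcases hw' with h | rfl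
      · have hxc : x ≠ c := fun h => hgo (h ▸ rfl)
        have hwm : w ∉ insert (L.length + 4) (f.erase x) := fun hm =>
          not_inFace_of_mem (card_of_mem_stackFaces hV hg) hm hwin
        obtain ⟨b, hxb, hbc, hfe⟩ : ∃ b, x ≠ b ∧ b ≠ c ∧ f = {x, b, c} := by
          obtain ⟨a, b, hab, hbc, hac, hfe, -⟩ := exists_triple hf3 hcf
          have hx := hxf
          rw [hfe] at hx
          simp only [Finset.mem_insert, Finset.mem_singleton] at hx
          rcases hx with rfl | rfl | rfl
          · exact ⟨b, hab, hbc, hfe⟩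
          · exact ⟨a, hab.symm, hac, by rw [hfe, Finset.insert_comm]⟩
          · exact absurd rfl hxc
        have hb : b ∈ f := by simp [hfe]
        have hex : f.erase x = {b, c} := by
          rw [hfe, Finset.erase_insert (by simp [hxb, hxc])]
        have hec : f.erase c = {x, b} := by
          rw [hfe]
          ext y
          simp only [Finset.mem_erase, Finset.mem_insert, Finset.mem_singleton]
          grind
        rw [hec, insert_pair_eq, inFace_triple hxb (hneN b hb) (hneN x hxf)] at hcin
        rw [hex, insert_pair_eq, inFace_triple hbc (hneN c hcf) (hneN b hb)] at hwin
        refine hcin.not_inTri_adjacent ?_ hwin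
        by_cases hwx : w = x
        · have := hp b (hlt b hb) c (hlt c hcf) x (hlt x hxf) hbc hxc.symm hxb.symm
          rw [hwx]
          exact mul_self_pos.2 this
        · have hwf : w ∉ f := fun h =>
            hwm (Finset.mem_insert_of_mem (Finset.mem_erase.2 ⟨hwx, h⟩))
          have := ho.outer w h hwf
          rw [hfe, inFace_triple hxb hbc hxc] at this
          rw [area_rotate]
          exact this.2.1
      · exact not_inFace_of_mem (card_of_mem_stackFaces hV hg) (Finset.mem_insert_self _ _) hwin
  · intro x hx hxn hxin
    have hx' : L.length + 4 < x := by simp only [List.length_cons] at hx; omega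
    obtain ⟨d, hd, hdx⟩ := InFace.subdivide hp hcard'
      (fun a ha => by have := lt_of_mem_stackFaces hV hmem' ha; simp at this; omega)
      (hlt c hcf) hxn (by have := lt_of_mem_stackFaces hL hf hcf; omega) hcin hxin
    rcases Finset.mem_insert.1 hd with rfl | hd
    · rw [hback] at hdx
      obtain ⟨g, hg, hgo, hgx⟩ := ho.cover x hx'.le hxn hdx
      refine ⟨g, mem_stackFaces_cons.2 (Or.inl ⟨hgo, hg⟩), ?_, hgx⟩
      rintro rfl
      exact lt_irrefl _ (lt_of_mem_stackFaces hL hg (Finset.mem_insert_self _ _))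
    · obtain ⟨hdc, hdf⟩ := Finset.mem_erase.1 hd
      rw [hswap d hdf hdc] at hdx
      refine ⟨_, mem_stackFaces_cons.2 (Or.inr ⟨d, hdf, rfl⟩), ?_, hdx⟩
      intro h
      have : d ∈ insert (L.length + 4) (f.erase d) := h ▸ Finset.mem_insert_of_mem hd
      rcases Finset.mem_insert.1 this with h | h
      · exact hneN d hdf h
      · exact Finset.notMem_erase d f h

lemma exists_isOuterFace {L : List (Finset ℕ)} {p : ℕ → Plane} {n : ℕ} (hL : StackValid L)
    (hp : GenericBelow p n) (hn : L.length + 4 ≤ n) (hc : CrossFree L p) :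
    ∃ o, IsOuterFace L p n o := by
  induction L with
  | nil => exact isOuterFace_nil hp hn hc
  | cons f L ih =>
    rw [List.length_cons] at hn
    obtain ⟨o, ho⟩ := ih hL.2 (by omega) hc.tail
    by_cases hin : InFace p o (L.length + 4)
    · exact ⟨o, ho.stack_inner hL.2 hL.1 hp (by omega) hc hin⟩
    · exact ho.stack_outer hL.2 hL.1 hp (by omega) hc hin

/-- A labelled point set carries at most one crossing-free stacked triangulation. -/
lemma stack_unique {L L' : List (Finset ℕ)} {p : ℕ → Plane} {n : ℕ} (hL : StackValid L)
    (hL' : StackValid L') (hlen : L.length = L'.length) (hp : GenericBelow p n)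
    (hn : L.length + 4 ≤ n) (hc : CrossFree L p) (hc' : CrossFree L' p) : L = L' := by
  induction L generalizing L' with
  | nil => exact (List.length_eq_zero_iff.1 hlen.symm).symm
  | cons f L ih =>
    cases L' with
    | nil => simp at hlen
    | cons f' L' =>
      simp only [List.length_cons, add_left_inj] at hlen hn
      obtain rfl := ih hL.2 hL'.2 hlen (by omega) hc.tail hc'.tail
      obtain ⟨o, ho⟩ := exists_isOuterFace hL.2 hp (by omega) hc.tail
      congr 1
      by_cases hin : InFace p o (L.length + 4)
      · obtain ⟨g, hg, hgo, hgin⟩ := ho.cover _ le_rfl (by omega) hin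
        rw [ho.eq_of_inFace hL.2 hL.1 hp (by omega) hc hg hgo hgin,
          ho.eq_of_inFace hL.2 hL'.1 hp (by omega) hc' hg hgo hgin]
      · rw [ho.eq_of_not_inFace hL.2 hL.1 hp (by omega) hc hin,
          ho.eq_of_not_inFace hL.2 hL'.1 hp (by omega) hc' hin]

/-- A point close to `p c`, in the cone spanned by the directions to `p a` and `p b` (if `s` is
positive) or in the opposite cone (if `s` is negative). -/
lemma exists_near {p : ℕ → Plane} {N : ℕ} (hp : GenericBelow p N) {a b c : ℕ} (ha : a < N)
    (hb : b < N) (hc : c < N) (hab : a ≠ b) (hbc : b ≠ c) (hac : a ≠ c) {s : ℝ} (hs : s ≠ 0) :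
    ∃ (v : Plane) (α β : ℝ), 0 < s * α ∧ 0 < s * β ∧
      (∀ q, area (p c) q v = α * area (p c) q (p a) + β * area (p c) q (p b)) ∧
      (∀ y < N, y ≠ c → area (p c) (p y) v ≠ 0) ∧
      ∀ x < N, ∀ y < N, x ≠ y → x ≠ c → y ≠ c →
        0 < area (p x) (p y) (p c) * area (p x) (p y) v := by
  obtain ⟨t, ht0, ht⟩ : ∃ t : ℝ, 0 < t ∧ ∀ y < N, y ≠ c →
      area (p c) (p y) (p a) + t * area (p c) (p y) (p b) ≠ 0 := by
    have h : ∀ᶠ t : ℝ in nhdsWithin 0 (Set.Ioi 0), ∀ y ∈ Finset.range N, y ≠ c →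
        area (p c) (p y) (p a) + t * area (p c) (p y) (p b) ≠ 0 := by
      rw [Filter.eventually_all_finset]
      intro y hy
      rw [Finset.mem_range] at hy
      by_cases hya : y = a
      · subst hya
        filter_upwards [self_mem_nhdsWithin] with t ht _
        have e : area (p c) (p y) (p y) = 0 := by unfold area; ring
        rw [e, zero_add]
        exact mul_ne_zero (ne_of_gt ht) (hp c hc y hy b hb hac.symm hab hbc.symm)
      · by_cases hyc : y = c
        · exact Filter.Eventually.of_forall fun t h => absurd hyc h
        · have h0 := hp c hc y hy a ha (Ne.symm hyc) hya hac.symm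
          have hcont : Continuous fun t : ℝ =>
              area (p c) (p y) (p a) + t * area (p c) (p y) (p b) := by fun_prop
          have := hcont.continuousAt.eventually_ne (x := 0) (by simpa using h0)
          exact (this.filter_mono nhdsWithin_le_nhds).mono fun t ht _ => ht
    obtain ⟨t, h1, h2⟩ := (h.and self_mem_nhdsWithin).exists
    exact ⟨t, h2, fun y hy => h1 y (Finset.mem_range.2 hy)⟩
  obtain ⟨ε, hε0, hε⟩ : ∃ ε : ℝ, 0 < ε ∧ ∀ x < N, ∀ y < N, x ≠ y → x ≠ c → y ≠ c →
      0 < area (p x) (p y) (p c) *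
        area (p x) (p y) (p c + (s * ε) • ((p a - p c) + t • (p b - p c))) := by
    have h : ∀ᶠ ε : ℝ in nhdsWithin 0 (Set.Ioi 0), ∀ x ∈ Finset.range N, ∀ y ∈ Finset.range N,
        x ≠ y → x ≠ c → y ≠ c → 0 < area (p x) (p y) (p c) *
          area (p x) (p y) (p c + (s * ε) • ((p a - p c) + t • (p b - p c))) := by
      simp only [Filter.eventually_all_finset, Filter.eventually_all]
      intro x hx y hy hxy hxc hyc
      rw [Finset.mem_range] at hx hy
      have hcont : Continuous fun ε : ℝ => area (p x) (p y) (p c) *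
          area (p x) (p y) (p c + (s * ε) • ((p a - p c) + t • (p b - p c))) := by
        simp only [area, PiLp.add_apply, PiLp.smul_apply, smul_eq_mul]
        fun_prop
      refine (hcont.continuousAt.eventually (lt_mem_nhds ?_)).filter_mono nhdsWithin_le_nhds
      simpa using mul_self_pos.2 (hp x hx y hy c hc hxy hyc hxc)
    obtain ⟨ε, h1, h2⟩ := (h.and self_mem_nhdsWithin).exists
    exact ⟨ε, h2, fun x hx y hy => h1 x (Finset.mem_range.2 hx) y (Finset.mem_range.2 hy)⟩
  have key : ∀ q, area (p c) q (p c + (s * ε) • ((p a - p c) + t • (p b - p c)))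
      = s * ε * area (p c) q (p a) + s * ε * t * area (p c) q (p b) := by
    intro q
    simp only [area, PiLp.add_apply, PiLp.sub_apply, PiLp.smul_apply, smul_eq_mul]
    ring
  have hss : 0 < s * s := mul_self_pos.2 hs
  refine ⟨_, s * ε, s * ε * t, ?_, ?_, key, ?_, hε⟩
  · nlinarith [mul_pos hss hε0]
  · nlinarith [mul_pos (mul_pos hss hε0) ht0]
  · intro y hy hyc
    rw [key, show ∀ A B : ℝ, s * ε * A + s * ε * t * B = s * ε * (A + t * B) by intros; ring]
    exact mul_ne_zero (mul_ne_zero hs hε0.ne') (ht y hy hyc)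

lemma GenericBelow.update {p : ℕ → Plane} {N : ℕ} (hp : GenericBelow p N) {v : Plane}
    (hv : ∀ x < N, ∀ y < N, x ≠ y → area (p x) (p y) v ≠ 0) :
    GenericBelow (Function.update p N v) (N + 1) := by
  intro i hi j hj k hk hij hjk hik
  have key : ∀ m, m < N + 1 → m = N ∨ (m < N ∧ m ≠ N) := fun m hm => by omega
  rcases key i hi with rfl | ⟨hi, hi'⟩
  · obtain ⟨hj, hj'⟩ := (key j hj).resolve_left hij.symm
    obtain ⟨hk, hk'⟩ := (key k hk).resolve_left hik.symm
    simp only [Function.update_self, Function.update_of_ne hj', Function.update_of_ne hk']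
    rw [← area_rotate]
    exact hv j hj k hk hjk
  · rcases key j hj with rfl | ⟨hj, hj'⟩
    · obtain ⟨hk, hk'⟩ := (key k hk).resolve_left hjk.symm
      simp only [Function.update_self, Function.update_of_ne hi', Function.update_of_ne hk']
      rw [area_swap_right]
      exact neg_ne_zero.2 (hv i hi k hk hik)
    · rcases key k hk with rfl | ⟨hk, hk'⟩
      · simp only [Function.update_self, Function.update_of_ne hi', Function.update_of_ne hj']
        exact hv i hi j hj hij
      · simp only [Function.update_of_ne hi', Function.update_of_ne hj', Function.update_of_ne hk']
        exact hp i hi j hj k hk hij hjk hik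

lemma not_cross_self (a b d : Plane) : ¬ Cross a b a d := by
  intro h
  have e : area a b a = 0 := by unfold area; ring
  have := h.1
  simp [e] at this

lemma Cross.swap_right {a b c d : Plane} (h : Cross a b c d) : Cross a b d c :=
  h.symm.swap_left.symm

/-- A new point close to `p c` sees the vertices of the face without crossings. -/
lemma CrossFree.update {f : Finset ℕ} {L : List (Finset ℕ)} {p : ℕ → Plane} (hL : StackValid L)
    (hf : f ∈ stackFaces L) (h : CrossFree L p) {c : ℕ} (hcf : c ∈ f) {v : Plane}
    (hv : ∀ x < L.length + 4, ∀ y < L.length + 4, x ≠ y → x ≠ c → y ≠ c →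
        0 < area (p x) (p y) (p c) * area (p x) (p y) v)
    (hsafe : ∀ a ∈ f, a ≠ c → ∀ y < L.length + 4, y ≠ c → y ≠ a → stackAdj L c y →
      ¬ Cross v (p a) (p c) (p y)) :
    CrossFree (f :: L) (Function.update p (L.length + 4) v) := by
  have hne : ∀ x y, stackAdj L x y → x ≠ L.length + 4 := fun x y hxy => (hxy.lt hL).ne
  have hnew : ∀ d ∈ f, ∀ x y, stackAdj L x y → ¬ Cross v (p d) (p x) (p y) := by
    intro d hd x y hxy hcr
    have hdl := lt_of_mem_stackFaces hL hf hd
    have hxl := hxy.lt hL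
    have hyl := hxy.symm.lt hL
    by_cases hxd : x = d
    · subst hxd; exact not_cross_self _ _ _ hcr.swap_left
    by_cases hyd : y = d
    · subst hyd; exact not_cross_self _ _ _ hcr.swap_left.swap_right
    by_cases hxc : x = c
    · subst hxc
      exact hsafe d hd (Ne.symm hxd) y hyl (hxy.ne hL).symm hyd hxy hcr
    by_cases hyc : y = c
    · subst hyc
      exact hsafe d hd (Ne.symm hyd) x hxl (hxy.ne hL) hxd hxy.symm hcr.swap_right
    have h3 := hv x hxl y hyl (hxy.ne hL) hxc hyc
    by_cases hdc : d = c
    · subst hdc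
      have := hcr.2
      linarith [mul_comm (area (p x) (p y) (p d)) (area (p x) (p y) v)]
    · have h1 := hv d hdl x hxl (Ne.symm hxd) hdc hxc
      have h2 := hv d hdl y hyl (Ne.symm hyd) hdc hyc
      refine h c d x y (stackAdj_of_mem hL hf hcf hd (Ne.symm hdc)) hxy ⟨?_, ?_⟩
      · have h4 := hcr.1
        rw [← area_rotate v, ← area_rotate v] at h4
        rw [← area_rotate (p c), ← area_rotate (p c)]
        by_contra h5
        push Not at h5
        nlinarith [mul_pos h1 h2]
      · have h4 := hcr.2
        by_contra h5
        push Not at h5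
        have h6 : 0 ≤ (area (p x) (p y) (p c) * area (p x) (p y) (p d)) *
          (area (p x) (p y) (p c) * area (p x) (p y) v) := mul_nonneg h5 h3.le
        have h7 : area (p x) (p y) (p c) ≠ 0 := left_ne_zero_of_mul h3.ne'
        nlinarith [mul_self_pos.2 h7]
  have hnew' : ∀ d ∈ f, ∀ x y, stackAdj (f :: L) x y →
      ¬ Cross v (p d) (Function.update p (L.length + 4) v x)
        (Function.update p (L.length + 4) v y) := by
    intro d hd x y hxy hcr
    rcases hxy with hxy | ⟨rfl, hy⟩ | ⟨rfl, hx⟩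
    · rw [Function.update_of_ne (hne x y hxy), Function.update_of_ne (hne y x hxy.symm)] at hcr
      exact hnew d hd x y hxy hcr
    · rw [Function.update_self] at hcr
      exact not_cross_self _ _ _ hcr
    · rw [Function.update_self] at hcr
      exact not_cross_self _ _ _ hcr.swap_right
  intro u w x y huw hxy hcr
  have hd : ∀ d ∈ f, Function.update p (L.length + 4) v d = p d := fun d hd =>
    Function.update_of_ne (lt_of_mem_stackFaces hL hf hd).ne _ _
  rcases huw with huw | ⟨rfl, hw⟩ | ⟨rfl, hu⟩
  · rcases hxy with hxy | ⟨rfl, hy⟩ | ⟨rfl, hx⟩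
    · rw [Function.update_of_ne (hne x y hxy), Function.update_of_ne (hne y x hxy.symm),
        Function.update_of_ne (hne u w huw), Function.update_of_ne (hne w u huw.symm)] at hcr
      exact h u w x y huw hxy hcr
    · have hcr := hcr.symm
      rw [Function.update_self, hd y hy] at hcr
      exact hnew' y hy u w (Or.inl huw) hcr
    · have hcr := hcr.swap_right.symm
      rw [Function.update_self, hd x hx] at hcr
      exact hnew' x hx u w (Or.inl huw) hcr
  · rw [Function.update_self, hd w hw] at hcr
    exact hnew' w hw x y hxy hcr
  · have hcr := hcr.swap_left
    rw [Function.update_self, hd u hu] at hcr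
    exact hnew' u hu x y hxy hcr

lemma mul_pos_trans {a b c : ℝ} (h1 : 0 < a * b) (h2 : 0 < b * c) : 0 < a * c := by
  have h3 : 0 < b * b := mul_self_pos.2 (left_ne_zero_of_mul h2.ne')
  refine pos_of_mul_pos_right (a := b * b) ?_ h3.le
  nlinarith [mul_pos h1 h2]

lemma not_cross_cone {a b c v y : Plane} {α β : ℝ} (hα : 0 < α) (hβ : 0 < β)
    (hv : ∀ q, area c q v = α * area c q a + β * area c q b)
    (hy : 0 < area a y c * area a y v) (h0 : area a b y ≠ 0) (hin : ¬ InTri a b c y)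
    (hcr : ¬ Cross c y a b) : ¬ Cross v a c y := by
  rintro ⟨h1, h2⟩
  have e1 : area v a c = -(β * area a b c) := by
    have := hv a
    unfold area at *; linarith
  have e2 : area v a y = area a y v := (area_rotate v a y).symm
  have e3 : area c y a = -area c a y := area_swap_right _ _ _
  have e4 : area c y b = area b c y := area_rotate _ _ _
  have e5 : area a y c = area c a y := area_rotate _ _ _
  rw [hv, e3, e4] at h2
  rw [e1, e2] at h1
  rw [e5] at hy
  have k1 : 0 < area a b c * area a y v := by
    refine pos_of_mul_pos_right (a := β) ?_ hβ.le
    linarith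
  have k2 : 0 < area a b c * area c a y := mul_pos_trans k1 (by linarith)
  have k3 : 0 < area c a y * area b c y := by
    refine pos_of_mul_pos_right (a := β) ?_ hβ.le
    nlinarith [mul_nonneg hα.le (mul_self_nonneg (area c a y))]
  have k4 : ¬ 0 < area a b c * area a b y := fun h => hin ⟨h, mul_pos_trans k2 k3, k2⟩
  refine hcr ⟨?_, lt_of_le_of_ne (not_lt.1 k4)
    (mul_ne_zero (left_ne_zero_of_mul k1.ne') h0)⟩
  rw [e3, e4]
  linarith

lemma not_cross_opposite_cone {a b c v y : Plane} {α β : ℝ} (hβ : β < 0)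
    (hv : ∀ q, area c q v = α * area c q a + β * area c q b)
    (hy : 0 < area a y c * area a y v) (hin : 0 < area c a b * area c a y) :
    ¬ Cross v a c y := by
  rintro ⟨h1, -⟩
  have e1 : area v a c = -(β * area c a b) := by
    have := hv a
    unfold area at *; linarith
  have e2 : area v a y = area a y v := (area_rotate v a y).symm
  have e5 : area a y c = area c a y := area_rotate _ _ _
  rw [e1, e2] at h1
  rw [e5] at hy
  have := mul_pos_trans hin hy
  nlinarith [mul_pos_of_neg_of_neg hβ (neg_lt_zero.2 this)]

lemma not_cross_neighbour {a b c v : Plane} {α β : ℝ} (hα : 0 < α)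
    (hv : ∀ q, area c q v = α * area c q a + β * area c q b) : ¬ Cross v a c b := by
  rintro ⟨-, h⟩
  have e : area c b b = 0 := by unfold area; ring
  rw [hv, e, mul_zero, add_zero] at h
  nlinarith [mul_nonneg hα.le (mul_self_nonneg (area c b a))]

lemma InTri.of_near {x y z c v : Plane} (h : InTri x y z c) (hxy : 0 < area x y c * area x y v)
    (hyz : 0 < area y z c * area y z v) (hzx : 0 < area z x c * area z x v) : InTri x y z v :=
  ⟨mul_pos_trans h.1 hxy, mul_pos_trans h.2.1 hyz, mul_pos_trans h.2.2 hzx⟩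

/-- `p` is a crossing-free drawing of the stacked triangulation with outer face `g`. -/
def IsDrawing (L : List (Finset ℕ)) (g : Finset ℕ) (p : ℕ → Plane) : Prop :=
  GenericBelow p (L.length + 4) ∧ CrossFree L p ∧ ∀ w < L.length + 4, w ∉ g → InFace p g w

/-- The inner faces of a drawing are empty. -/
lemma IsDrawing.not_inFace {L : List (Finset ℕ)} {f g : Finset ℕ} {p : ℕ → Plane}
    (h : IsDrawing L g p) (hL : StackValid L) (hf : f ∈ stackFaces L) (hg : g ∈ stackFaces L)
    (hfg : f ≠ g) {w : ℕ} (hw : w < L.length + 4) : ¬ InFace p f w := by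
  obtain ⟨hp, hc, hout⟩ := h
  obtain ⟨o, ho⟩ := exists_isOuterFace hL hp le_rfl hc
  obtain ⟨x, hx, hxg⟩ : ∃ x ∈ Finset.range (L.length + 4), x ∉ g := by
    refine Finset.exists_mem_notMem_of_card_lt_card ?_
    rw [card_of_mem_stackFaces hL hg, Finset.card_range]
    omega
  rw [Finset.mem_range] at hx
  have hgo : g = o := by
    by_contra hgo
    exact ho.empty g hg hgo x hx (hout x hx hxg)
  exact ho.empty f hf (hgo ▸ hfg) w hw

lemma area_ne_zero_of_near {p : ℕ → Plane} {N c : ℕ} {v : Plane}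
    (hcv : ∀ y < N, y ≠ c → area (p c) (p y) v ≠ 0)
    (hv : ∀ x < N, ∀ y < N, x ≠ y → x ≠ c → y ≠ c →
        0 < area (p x) (p y) (p c) * area (p x) (p y) v) :
    ∀ x < N, ∀ y < N, x ≠ y → area (p x) (p y) v ≠ 0 := by
  intro x hx y hy hxy
  by_cases hxc : x = c
  · subst hxc
    exact hcv y hy (Ne.symm hxy)
  by_cases hyc : y = c
  · subst hyc
    exact area_swap_ne (hcv x hx hxc)
  exact right_ne_zero_of_mul (hv x hx y hy hxy hxc hyc).ne'

lemma inFace_update_iff {p : ℕ → Plane} {g : Finset ℕ} {N w : ℕ} {v : Plane}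
    (hg : ∀ x ∈ g, x < N) (hw : w < N) : InFace (Function.update p N v) g w ↔ InFace p g w := by
  have h : ∀ x < N, Function.update p N v x = p x := fun x hx => Function.update_of_ne hx.ne _ _
  unfold InFace
  rw [h w hw]
  constructor
  · intro H a ha b hb c hc
    simpa only [h a (hg a ha), h b (hg b hb), h c (hg c hc)] using H a ha b hb c hc
  · intro H a ha b hb c hc
    simpa only [h a (hg a ha), h b (hg b hb), h c (hg c hc)] using H a ha b hb c hc

/-- Stacking a vertex into an inner face of a drawing. -/
lemma IsDrawing.exists_stack_inner {L : List (Finset ℕ)} {f g : Finset ℕ} {p : ℕ → Plane}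
    (h : IsDrawing L g p) (hL : StackValid L) (hf : f ∈ stackFaces L) (hg : g ∈ stackFaces L)
    (hfg : f ≠ g) : ∃ p', IsDrawing (f :: L) g p' := by
  have hempty := fun w hw => h.not_inFace hL hf hg hfg (w := w) hw
  obtain ⟨hp, hc, hout⟩ := h
  have hf3 := card_of_mem_stackFaces hL hf
  obtain ⟨c, hcf, hcg⟩ : ∃ c ∈ f, c ∉ g := by
    by_contra! hsub
    exact hfg (eq_of_subset_face hL hf hg hsub)
  have hlt := fun x hx => lt_of_mem_stackFaces hL hf (w := x) hx
  have hltg := fun x hx => lt_of_mem_stackFaces hL hg (w := x) hx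
  obtain ⟨a, b, hab, hbc, hac, hfe, -⟩ := exists_triple hf3 hcf
  have haf : a ∈ f := by simp [hfe]
  have hbf : b ∈ f := by simp [hfe]
  obtain ⟨v, α, β, hα, hβ, hcone, hcv, hv⟩ := exists_near hp (hlt a haf) (hlt b hbf) (hlt c hcf)
    hab hbc hac one_ne_zero
  rw [one_mul] at hα hβ
  have hadj := fun x hx y hy hxy => stackAdj_of_mem hL hf (a := x) (b := y) hx hy hxy
  refine ⟨Function.update p (L.length + 4) v,
    hp.update (area_ne_zero_of_near hcv hv), hc.update hL hf hcf hv ?_, ?_⟩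
  · intro d hd hdc y hy hyc hyd hcy
    have hdab : d = a ∨ d = b := by
      rw [hfe] at hd
      simpa [hdc] using hd
    rcases hdab with rfl | rfl
    · by_cases hyb : y = b
      · subst hyb
        exact not_cross_neighbour hα hcone
      · refine not_cross_cone hα hβ hcone (hv d (hlt d haf) y hy (Ne.symm hyd) hdc hyc)
          (hp d (hlt d haf) b (hlt b hbf) y hy hab (Ne.symm hyb) (Ne.symm hyd)) ?_
          (hc c y d b hcy (hadj d haf b hbf hab))
        rw [← inFace_triple (p := p) hab hbc hac, ← hfe]
        exact hempty y hy
    · have hcone' : ∀ q, area (p c) q v = β * area (p c) q (p d) + α * area (p c) q (p a) :=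
        fun q => by rw [hcone, add_comm]
      by_cases hya : y = a
      · subst hya
        exact not_cross_neighbour hβ hcone'
      · refine not_cross_cone hβ hα hcone' (hv d (hlt d hbf) y hy (Ne.symm hyd) hdc hyc)
          (hp d (hlt d hbf) a (hlt a haf) y hy hab.symm (Ne.symm hya) (Ne.symm hyd)) ?_
          (hc c y d a hcy (hadj d hbf a haf hab.symm))
        intro hin
        refine hempty y hy ?_
        rw [hfe, inFace_triple hab hbc hac]
        exact hin.swap
  · intro w hw hwg
    rcases Nat.lt_succ_iff_lt_or_eq.1
      (show w < (L.length + 4).succ by simpa [add_right_comm] using hw) with hw | rfl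
    · rw [inFace_update_iff hltg hw]
      exact hout w hw hwg
    · intro x hx y hy z hz hxy hyz hxz
      have hne : ∀ u ∈ g, u ≠ c := fun u hu huc => hcg (huc ▸ hu)
      rw [Function.update_self, Function.update_of_ne (hltg x hx).ne,
        Function.update_of_ne (hltg y hy).ne, Function.update_of_ne (hltg z hz).ne]
      exact (hout c (hlt c hcf) hcg x hx y hy z hz hxy hyz hxz).of_near
        (hv x (hltg x hx) y (hltg y hy) hxy (hne x hx) (hne y hy))
        (hv y (hltg y hy) z (hltg z hz) hyz (hne y hy) (hne z hz))
        (hv z (hltg z hz) x (hltg x hx) hxz.symm (hne z hz) (hne x hx))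

/-- Stacking a vertex into the outer face of a drawing, with a prescribed new outer face. -/
lemma IsDrawing.exists_stack_outer {L : List (Finset ℕ)} {f : Finset ℕ} {p : ℕ → Plane}
    (h : IsDrawing L f p) (hL : StackValid L) (hf : f ∈ stackFaces L) {c : ℕ} (hcf : c ∈ f) :
    ∃ p', IsDrawing (f :: L) (insert (L.length + 4) (f.erase c)) p' := by
  obtain ⟨hp, hc, hout⟩ := h
  have hf3 := card_of_mem_stackFaces hL hf
  have hlt := fun x hx => lt_of_mem_stackFaces hL hf (w := x) hx
  obtain ⟨a, b, hab, hbc, hac, hfe, hfc⟩ := exists_triple hf3 hcf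
  have haf : a ∈ f := by simp [hfe]
  have hbf : b ∈ f := by simp [hfe]
  have ha := hlt a haf
  have hb := hlt b hbf
  have hcN := hlt c hcf
  obtain ⟨v, α, β, hα, hβ, hcone, hcv, hv⟩ := exists_near hp ha hb hcN
    hab hbc hac (s := -1) (by norm_num)
  replace hα : α < 0 := by linarith
  replace hβ : β < 0 := by linarith
  have hS : 0 < area (p a) (p b) (p c) * area (p a) (p b) (p c) :=
    mul_self_pos.2 (hp a ha b hb c hcN hab hbc hac)
  have hin : ∀ y < L.length + 4, y ≠ a → y ≠ b → y ≠ c →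
      InTri (p a) (p b) (p c) (p y) := by
    intro y hy hya hyb hyc
    rw [← inFace_triple (p := p) hab hbc hac, ← hfe]
    exact hout y hy (by simp [hfe, hya, hyb, hyc])
  have e1 : area (p c) (p a) (p b) = area (p a) (p b) (p c) := by rw [area_rotate, area_rotate]
  have e2 : area (p c) (p b) (p a) = -area (p a) (p b) (p c) := by
    rw [area_swap_right, e1]
  refine ⟨Function.update p (L.length + 4) v,
    hp.update (area_ne_zero_of_near hcv hv), hc.update hL hf hcf hv ?_, ?_⟩
  · intro d hd hdc y hy hyc hyd hcy
    have hdab : d = a ∨ d = b := by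
      rw [hfe] at hd
      simpa [hdc] using hd
    rcases hdab with rfl | rfl
    · refine not_cross_opposite_cone hβ hcone (hv d ha y hy (Ne.symm hyd) hdc hyc) ?_
      rw [e1]
      by_cases hyb : y = b
      · rw [hyb, e1]
        exact hS
      · exact (hin y hy hyd hyb hyc).2.2
    · have hcone' : ∀ q, area (p c) q v = β * area (p c) q (p d) + α * area (p c) q (p a) :=
        fun q => by rw [hcone, add_comm]
      refine not_cross_opposite_cone hα hcone' (hv d hb y hy (Ne.symm hyd) hdc hyc) ?_
      rw [e2]
      by_cases hya : y = a
      · rw [hya, e2, neg_mul_neg]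
        exact hS
      · rw [area_swap (p d) (p c), neg_mul_neg]
        exact (hin y hy hya hyd hyc).2.1
  · intro w hw hwg
    rw [hfc, insert_pair_eq] at hwg ⊢
    simp only [Finset.mem_insert, Finset.mem_singleton, not_or] at hwg
    obtain ⟨hwa, hwb, hwN⟩ := hwg
    replace hw : w < L.length + 4 := by
      rw [List.length_cons] at hw
      omega
    rw [inFace_triple hab hb.ne ha.ne, Function.update_self, Function.update_of_ne ha.ne,
      Function.update_of_ne hb.ne, Function.update_of_ne hw.ne]
    have hSv := hv a ha b hb hab hac hbc
    have hvS := hSv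
    rw [mul_comm] at hvS
    have r1 : area (p b) v (p c) = area (p c) (p b) v := area_rotate _ _ _
    have r2 : area v (p a) (p c) = -area (p c) (p a) v := by
      unfold area; ring
    by_cases hwc : w = c
    · subst hwc
      refine ⟨hvS, mul_pos_trans hvS ?_, mul_pos_trans hvS ?_⟩
      · rw [r1, hcone, e2, show area (p w) (p b) (p b) = 0 by unfold area; ring]
        nlinarith [mul_pos_of_neg_of_neg hα (neg_lt_zero.2 hS)]
      · rw [r2, hcone, e1, show area (p w) (p a) (p a) = 0 by unfold area; ring]
        nlinarith [mul_pos_of_neg_of_neg hβ (neg_lt_zero.2 hS)]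
    · obtain ⟨i1, i2, i3⟩ := hin w hw hwa hwb hwc
      refine ⟨mul_pos_trans hvS i1, mul_pos_trans (mul_pos_trans hvS i2) ?_,
        mul_pos_trans (mul_pos_trans hvS i3) ?_⟩
      · have := hv w hw b hb hwb hwc hbc
        rwa [area_rotate (p c), area_rotate (p b), area_rotate v, area_rotate (p b)] at *
      · have := hv a ha w hw (Ne.symm hwa) hac hwc
        rwa [area_rotate v, area_rotate (p c)] at *

/-- A triangle together with an interior point. -/
def basePoint (i : ℕ) : ℤ × ℤ :=
  if i = 0 then (0, 0) else if i = 1 then (3, 0) else if i = 2 then (0, 3) else (1, 1)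

/-- The integer version of `area` for the points `basePoint`. -/
def baseArea (i j k : ℕ) : ℤ :=
  ((basePoint j).1 - (basePoint i).1) * ((basePoint k).2 - (basePoint i).2)
    - ((basePoint k).1 - (basePoint i).1) * ((basePoint j).2 - (basePoint i).2)

lemma area_basePoint (i j k : ℕ) :
    area !₂[((basePoint i).1 : ℝ), ((basePoint i).2 : ℝ)]
      !₂[((basePoint j).1 : ℝ), ((basePoint j).2 : ℝ)]
      !₂[((basePoint k).1 : ℝ), ((basePoint k).2 : ℝ)] = (baseArea i j k : ℝ) := by
  simp [area, baseArea]

set_option synthInstance.maxSize 1000 in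
lemma exists_isDrawing_nil {g : Finset ℕ} (hg : g ∈ stackFaces []) :
    ∃ p, IsDrawing [] g p := by
  obtain ⟨m, hm, rfl⟩ := mem_stackFaces_nil.1 hg
  have hσ : ∀ m < 4, ∀ i < 4, Equiv.swap m 3 i < 4 := by decide
  have hσ' : ∀ m < 4, ∀ i < 4, i ≠ m → Equiv.swap m 3 i < 3 := by decide
  have hinj : ∀ {i j : ℕ}, i ≠ j → Equiv.swap m 3 i ≠ Equiv.swap m 3 j := fun h =>
    (Equiv.swap m 3).injective.ne h
  refine ⟨fun i => !₂[((basePoint (Equiv.swap m 3 i)).1 : ℝ),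
    ((basePoint (Equiv.swap m 3 i)).2 : ℝ)], ?_, ?_, ?_⟩
  · intro i hi j hj k hk hij hjk hik
    have key : ∀ i < 4, ∀ j < 4, ∀ k < 4, i ≠ j ∧ j ≠ k ∧ i ≠ k → baseArea i j k ≠ 0 := by
      decide
    rw [area_basePoint]
    exact_mod_cast key _ (hσ m hm i hi) _ (hσ m hm j hj) _ (hσ m hm k hk)
      ⟨hinj hij, hinj hjk, hinj hik⟩
  · rintro u v x y ⟨hu, hv, -⟩ ⟨hx, hy, -⟩
    have key : ∀ u < 4, ∀ v < 4, ∀ x < 4, ∀ y < 4, ¬ (baseArea u v x * baseArea u v y < 0 ∧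
        baseArea x y u * baseArea x y v < 0) := by
      decide
    simp only [Cross, area_basePoint]
    exact_mod_cast key _ (hσ m hm u hu) _ (hσ m hm v hv) _ (hσ m hm x hx) _ (hσ m hm y hy)
  · intro w hw hwm
    obtain rfl : w = m := by
      by_contra hne
      exact hwm (Finset.mem_erase.2 ⟨hne, Finset.mem_range.2 (by simpa using hw)⟩)
    intro a ha b hb c hc hab hbc hac
    rw [Finset.mem_erase, Finset.mem_range] at ha hb hc
    have key : ∀ a < 3, ∀ b < 3, ∀ c < 3, a ≠ b ∧ b ≠ c ∧ a ≠ c →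
        0 < baseArea a b c * baseArea a b 3 ∧ 0 < baseArea a b c * baseArea b c 3 ∧
          0 < baseArea a b c * baseArea c a 3 := by
      decide
    simp only [InTri, area_basePoint, Equiv.swap_apply_left]
    exact_mod_cast key _ (hσ' w hm a ha.2 ha.1) _ (hσ' w hm b hb.2 hb.1) _
      (hσ' w hm c hc.2 hc.1) ⟨hinj hab, hinj hbc, hinj hac⟩

/-- Every stacked triangulation has a drawing with any prescribed outer face. -/
lemma exists_isDrawing {L : List (Finset ℕ)} (hL : StackValid L) {g : Finset ℕ}
    (hg : g ∈ stackFaces L) : ∃ p, IsDrawing L g p := by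
  induction L generalizing g with
  | nil => exact exists_isDrawing_nil hg
  | cons f L ih =>
    rcases mem_stackFaces_cons.1 hg with ⟨hgf, hgL⟩ | ⟨c, hc, rfl⟩
    · obtain ⟨p, hp⟩ := ih hL.2 hgL
      exact hp.exists_stack_inner hL.2 hL.1 hgL hgf.symm
    · obtain ⟨p, hp⟩ := ih hL.2 hL.1
      exact hp.exists_stack_outer hL.2 hL.1 hc

/-- No two edges of `G` cross properly when the vertices are placed at `p`. -/
def IsCrossFree {n : ℕ} (G : SimpleGraph (Fin n)) (p : Fin n → Plane) : Prop :=
  ∀ u v x y, G.Adj u v → G.Adj x y → ¬ Cross (p u) (p v) (p x) (p y)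

lemma GenPos.area_ne_zero {n : ℕ} {p : Fin n → Plane} (h : GenPos p) {i j k : Fin n} (hij : i ≠ j)
    (hik : i ≠ k) (hjk : j ≠ k) : area (p i) (p j) (p k) ≠ 0 := by
  have := h i j k hij hik hjk
  rwa [orient_eq_sign_area, Ne, Real.sign_eq_zero_iff] at this

lemma GenPos.injective {n : ℕ} (hn : 3 ≤ n) {p : Fin n → Plane} (h : GenPos p) :
    Function.Injective p := by
  intro i j hij
  by_contra hne
  obtain ⟨k, hk⟩ : ∃ k, k ∉ ({i, j} : Finset (Fin n)) := by
    by_contra! hall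
    have h1 := Finset.card_le_card (fun k _ => hall k : Finset.univ ⊆ ({i, j} : Finset (Fin n)))
    have h2 := Finset.card_le_two (a := i) (b := j)
    rw [Finset.card_univ, Fintype.card_fin] at h1
    omega
  simp only [Finset.mem_insert, Finset.mem_singleton, not_or] at hk
  refine h.area_ne_zero hne (Ne.symm hk.1) (Ne.symm hk.2) ?_
  rw [hij]
  unfold area
  ring

lemma area_eq_zero_of_mem_segment {a b z : Plane} (hz : z ∈ segment ℝ a b) : area a b z = 0 := by
  obtain ⟨r, s, -, -, hrs, rfl⟩ := hz
  obtain rfl : r = 1 - s := by linarith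
  simp only [area, PiLp.add_apply, PiLp.smul_apply, smul_eq_mul]
  ring

lemma area_convex_combination {a b c d : Plane} {r s : ℝ} (hrs : r + s = 1) :
    area a b (r • c + s • d) = r * area a b c + s * area a b d := by
  obtain rfl : r = 1 - s := by linarith
  simp only [area, PiLp.add_apply, PiLp.smul_apply, smul_eq_mul]
  ring

lemma mul_neg_of_common_point {a b c d z : Plane} (hz : z ∈ segment ℝ a b)
    (hz' : z ∈ segment ℝ c d) (hc : area a b c ≠ 0) (hd : area a b d ≠ 0) :
    area a b c * area a b d < 0 := by
  have h0 := area_eq_zero_of_mem_segment hz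
  obtain ⟨r, s, hr, hs, hrs, rfl⟩ := hz'
  rw [area_convex_combination hrs] at h0
  by_contra h
  have h1 : 0 < area a b c * area a b d :=
    lt_of_le_of_ne (not_lt.1 h) (mul_ne_zero hc hd).symm
  have h2 : (r * area a b c + s * area a b d) * (area a b c + area a b d) = 0 := by
    rw [h0, zero_mul]
  obtain rfl : r = 1 - s := by linarith
  nlinarith [mul_nonneg hr (mul_self_nonneg (area a b c)),
    mul_nonneg hs (mul_self_nonneg (area a b d))]

lemma eq_of_common_point {a b d z : Plane} (hz : z ∈ segment ℝ a b)
    (hz' : z ∈ segment ℝ a d) (hd : area a b d ≠ 0) : z = a := by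
  have h0 := area_eq_zero_of_mem_segment hz
  obtain ⟨r, s, hr, hs, hrs, rfl⟩ := hz'
  rw [area_convex_combination hrs, show area a b a = 0 by unfold area; ring, mul_zero,
    zero_add] at h0
  obtain rfl : s = 0 := (mul_eq_zero.1 h0).resolve_right hd
  obtain rfl : r = 1 := by linarith
  simp

/-- In general position, a drawing without proper crossings is a straight-line embedding. -/
lemma IsCrossFree.isSLEmbedding {n : ℕ} (hn : 3 ≤ n) {G : SimpleGraph (Fin n)} {p : Fin n → Plane}
    (hp : GenPos p) (h : IsCrossFree G p) : IsSLEmbedding G p := by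
  refine ⟨hp.injective hn, ?_, ?_⟩
  · rintro u v x y huv hxy hne z ⟨hz, hz'⟩
    have shared : ∀ {a b d : Fin n}, G.Adj a b → G.Adj a d → b ≠ d →
        z ∈ segment ℝ (p a) (p b) → z ∈ segment ℝ (p a) (p d) → p a = z :=
      fun hab had hbd h1 h2 => (eq_of_common_point h1 h2 (hp.area_ne_zero hab.ne had.ne hbd)).symm
    by_cases hux : u = x
    · subst hux
      exact ⟨u, by simp, shared huv hxy (fun hvy => hne (by rw [hvy])) hz hz'⟩
    by_cases huy : u = y
    · subst huy
      rw [segment_symm ℝ (p x)] at hz'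
      exact ⟨u, by simp, shared huv hxy.symm (fun hvy => hne (by rw [hvy, Sym2.eq_swap])) hz hz'⟩
    by_cases hvx : v = x
    · subst hvx
      rw [segment_symm ℝ (p u)] at hz
      exact ⟨v, by simp, shared huv.symm hxy (fun hvy => hne (by rw [hvy, Sym2.eq_swap])) hz hz'⟩
    by_cases hvy : v = y
    · subst hvy
      rw [segment_symm ℝ (p u)] at hz
      rw [segment_symm ℝ (p x)] at hz'
      exact ⟨v, by simp, shared huv.symm hxy.symm (fun hvy => hne (by rw [hvy])) hz hz'⟩
    refine absurd ⟨?_, ?_⟩ (h u v x y huv hxy)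
    · exact mul_neg_of_common_point hz hz' (hp.area_ne_zero huv.ne hux hvx)
        (hp.area_ne_zero huv.ne huy hvy)
    · exact mul_neg_of_common_point hz' hz (hp.area_ne_zero hxy.ne (Ne.symm hux) (Ne.symm huy))
        (hp.area_ne_zero hxy.ne (Ne.symm hvx) (Ne.symm hvy))
  · intro u v w huv hwu hwv hw
    exact hp.area_ne_zero huv.ne (Ne.symm hwu) (Ne.symm hwv)
      (area_eq_zero_of_mem_segment (openSegment_subset_segment _ _ _ hw))

/-- Properly crossing segments are not separated by a line. -/
lemma Cross.not_separated {a b c d : Plane} (h : Cross a b c d) (f : Plane →L[ℝ] ℝ) {s t : ℝ}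
    (hst : s < t) (ha : f a < s) (hb : f b < s) (hc : t < f c) (hd : t < f d) : False := by
  have e : area c d b • a - area c d a • b + area a b d • c - area a b c • d = 0 := by
    ext i
    fin_cases i <;>
    simp only [area, PiLp.add_apply, PiLp.sub_apply, PiLp.smul_apply, smul_eq_mul,
      PiLp.zero_apply, Fin.zero_eta, Fin.mk_one] <;>
    ring
  have e' : area c d b - area c d a + area a b d - area a b c = 0 := by
    unfold area; ring
  have e'' := congrArg f e
  simp only [map_add, map_sub, map_smul, smul_eq_mul, map_zero] at e''
  obtain ⟨h1, h2⟩ := h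
  generalize area c d b = Q at *
  generalize area c d a = P at *
  generalize area a b d = Y at *
  generalize area a b c = X at *
  obtain rfl : X = Q - P + Y := by linarith
  rcases mul_neg_iff.1 h1 with ⟨i1, i2⟩ | ⟨i1, i2⟩ <;>
  rcases mul_neg_iff.1 h2 with ⟨j1, j2⟩ | ⟨j1, j2⟩
  · linarith
  · nlinarith [mul_pos j2 (sub_pos.2 ha), mul_pos (neg_pos.2 j1) (sub_pos.2 hb),
      mul_pos i1 (sub_pos.2 hd), mul_pos (neg_pos.2 i2) (sub_pos.2 hc),
      mul_pos (sub_pos.2 hst) (sub_pos.2 (j1.trans j2))]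
  · nlinarith [mul_pos j1 (sub_pos.2 hb), mul_pos (neg_pos.2 j2) (sub_pos.2 ha),
      mul_pos i2 (sub_pos.2 hc), mul_pos (neg_pos.2 i1) (sub_pos.2 hd),
      mul_pos (sub_pos.2 hst) (sub_pos.2 (j2.trans j1))]
  · linarith

lemma isCompact_plane_segment (a b : Plane) : IsCompact (segment ℝ a b) := by
  rw [segment_eq_image]
  exact isCompact_Icc.image (by fun_prop)

/-- Embeddings stay crossing-free under small perturbations. -/
lemma IsSLEmbedding.eventually_isCrossFree {n : ℕ} {G : SimpleGraph (Fin n)}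
    {q : ℝ → Fin n → Plane} (hq : ∀ i, Continuous fun t => q t i) (h : IsSLEmbedding G (q 0)) :
    ∀ᶠ t in nhds 0, IsCrossFree G (q t) := by
  simp only [IsCrossFree, Filter.eventually_all]
  intro u v x y huv hxy
  by_cases hux : u = x
  · exact Filter.Eventually.of_forall fun t hc => by
      rw [hux] at hc
      exact not_cross_self _ _ _ hc
  by_cases huy : u = y
  · exact Filter.Eventually.of_forall fun t hc => by
      rw [huy] at hc
      exact not_cross_self _ _ _ hc.swap_right
  by_cases hvx : v = x
  · exact Filter.Eventually.of_forall fun t hc => by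
      rw [hvx] at hc
      exact not_cross_self _ _ _ hc.swap_left
  by_cases hvy : v = y
  · exact Filter.Eventually.of_forall fun t hc => by
      rw [hvy] at hc
      exact not_cross_self _ _ _ hc.swap_left.swap_right
  have hdisj : Disjoint (segment ℝ (q 0 u) (q 0 v)) (segment ℝ (q 0 x) (q 0 y)) := by
    rw [Set.disjoint_iff_inter_eq_empty, ← Set.subset_empty_iff]
    refine (h.2.1 u v x y huv hxy ?_).trans ?_
    · simp [hux, huy]
    · rintro _ ⟨w, ⟨hw, hw'⟩, -⟩
      simp only [Set.mem_insert_iff, Set.mem_singleton_iff] at hw hw'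
      rcases hw with rfl | rfl <;> rcases hw' with hw' | hw' <;> contradiction
  obtain ⟨f, s, t, hs, hst, ht⟩ := geometric_hahn_banach_compact_closed (convex_segment _ _)
    (isCompact_plane_segment _ _) (convex_segment _ _) (isCompact_plane_segment _ _).isClosed hdisj
  have hfq : ∀ i, Continuous fun t => f (q t i) := fun i => f.continuous.comp (hq i)
  filter_upwards [
    (hfq u).continuousAt.eventually (gt_mem_nhds (hs _ (left_mem_segment ℝ _ _))),
    (hfq v).continuousAt.eventually (gt_mem_nhds (hs _ (right_mem_segment ℝ _ _))),
    (hfq x).continuousAt.eventually (lt_mem_nhds (ht _ (left_mem_segment ℝ _ _))),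
    (hfq y).continuousAt.eventually (lt_mem_nhds (ht _ (right_mem_segment ℝ _ _)))]
    with r h1 h2 h3 h4 hc
  exact hc.not_separated f hst h1 h2 h3 h4

lemma eventually_quadratic_ne_zero {A B C : ℝ} (hC : C ≠ 0) :
    ∀ᶠ t : ℝ in nhdsWithin 0 (Set.Ioi 0), A + B * t + C * t ^ 2 ≠ 0 := by
  by_cases hA : A = 0
  · subst hA
    have h : ∀ᶠ t : ℝ in nhdsWithin 0 (Set.Ioi 0), B + C * t ≠ 0 := by
      by_cases hB : B = 0
      · subst hB
        filter_upwards [self_mem_nhdsWithin] with t ht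
        simpa using ⟨hC, ne_of_gt ht⟩
      · have hcont : Continuous fun t : ℝ => B + C * t := by fun_prop
        exact (hcont.continuousAt.eventually_ne (x := 0) (by simpa using hB)).filter_mono
          nhdsWithin_le_nhds
    filter_upwards [h, self_mem_nhdsWithin] with t h1 ht
    rw [show 0 + B * t + C * t ^ 2 = t * (B + C * t) by ring]
    exact mul_ne_zero (ne_of_gt ht) h1
  · have hcont : Continuous fun t : ℝ => A + B * t + C * t ^ 2 := by fun_prop
    exact (hcont.continuousAt.eventually_ne (x := 0) (by simpa using hA)).filter_mono
      nhdsWithin_le_nhds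

/-- Moving points along the moment curve brings them into general position. -/
lemma eventually_genPos {n : ℕ} (p : Fin n → Plane) :
    ∀ᶠ t : ℝ in nhdsWithin 0 (Set.Ioi 0),
      GenPos fun i => p i + t • !₂[((i : ℕ) : ℝ), ((i : ℕ) : ℝ) ^ 2] := by
  simp only [GenPos, orient_eq_sign_area, Ne, Real.sign_eq_zero_iff, Filter.eventually_all]
  intro i j k hij hik hjk
  have hV : (((j : ℕ) : ℝ) - (i : ℕ)) * (((k : ℕ) : ℝ) - (i : ℕ)) *
      (((k : ℕ) : ℝ) - (j : ℕ)) ≠ 0 := by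
    refine mul_ne_zero (mul_ne_zero ?_ ?_) ?_ <;>
    · rw [sub_ne_zero, Ne, Nat.cast_inj, Fin.val_inj]
      exact Ne.symm ‹_›
  have := eventually_quadratic_ne_zero (A := area (p i) (p j) (p k))
    (B := (p j 0 - p i 0) * (((k : ℕ) : ℝ) ^ 2 - ((i : ℕ) : ℝ) ^ 2)
      + (((j : ℕ) : ℝ) - (i : ℕ)) * (p k 1 - p i 1)
      - (p k 0 - p i 0) * (((j : ℕ) : ℝ) ^ 2 - ((i : ℕ) : ℝ) ^ 2)
      - (((k : ℕ) : ℝ) - (i : ℕ)) * (p j 1 - p i 1)) hV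
  refine this.mono fun t ht h0 => ht ?_
  rw [← h0]
  simp [area]
  ring

/-- A simultaneously embeddable family has crossing-free drawings on a common labelled point set
in general position. -/
lemma SimultaneouslyEmbeddable.exists_genPos {n : ℕ} {𝒢 : Set (SimpleGraph (Fin n))}
    (h : SimultaneouslyEmbeddable 𝒢) : ∃ p : Fin n → Plane, GenPos p ∧
      ∀ G ∈ 𝒢, ∃ σ : Equiv.Perm (Fin n), IsCrossFree G (p ∘ σ) := by
  obtain ⟨P, hP, hemb⟩ := h
  let e := P.equivFinOfCardEq hP
  let p : Fin n → Plane := fun i => (e.symm i : Plane)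
  let q : ℝ → Fin n → Plane := fun t i => p i + t • !₂[((i : ℕ) : ℝ), ((i : ℕ) : ℝ) ^ 2]
  have hσ : ∀ G ∈ 𝒢, ∃ σ : Equiv.Perm (Fin n), IsSLEmbedding G (q 0 ∘ σ) := by
    intro G hG
    obtain ⟨π, hπ, hr⟩ := hemb G hG
    have hmem : ∀ i, π i ∈ P := fun i => by
      rw [← Finset.mem_coe, ← hr]
      exact Set.mem_range_self i
    have hinj : Function.Injective fun i => e ⟨π i, hmem i⟩ := fun i j hij =>
      hπ.1 (congrArg Subtype.val (e.injective hij))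
    refine ⟨Equiv.ofBijective _ (Finite.injective_iff_bijective.1 hinj), ?_⟩
    convert hπ using 1
    funext i
    simp [q, p]
  have hev : ∀ᶠ t in nhds 0, ∀ G, G ∈ 𝒢 → ∃ σ : Equiv.Perm (Fin n), IsCrossFree G (q t ∘ σ) := by
    rw [Filter.eventually_all]
    intro G
    by_cases hG : G ∈ 𝒢
    · obtain ⟨σ, hσ⟩ := hσ G hG
      have := IsSLEmbedding.eventually_isCrossFree (q := fun t => q t ∘ σ)
        (fun i => by simp only [q, Function.comp_apply]; fun_prop) hσ
      exact this.mono fun t ht _ => ⟨σ, ht⟩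
    · exact Filter.Eventually.of_forall fun t h => absurd h hG
  obtain ⟨t, h1, h2⟩ := ((eventually_genPos p).and (hev.filter_mono nhdsWithin_le_nhds)).exists
  exact ⟨q t, h1, h2⟩

lemma OTIso.orient_eq {n : ℕ} {p q : Fin n → Plane} (h : OTIso p q) (i j k : Fin n) :
    orient (p i) (p j) (p k) = orient (q i) (q j) (q k) := by
  have hswap : ∀ {i j k : Fin n}, orient (p i) (p j) (p k) = orient (q i) (q j) (q k) →
      orient (p j) (p i) (p k) = orient (q j) (q i) (q k) := by
    intro i j k h
    rw [orient_eq_sign_area, orient_eq_sign_area] at *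
    rw [area_swap (p i), area_swap (q i), Real.sign_neg, Real.sign_neg, h]
  have hrot : ∀ {i j k : Fin n}, orient (p i) (p j) (p k) = orient (q i) (q j) (q k) →
      orient (p j) (p k) (p i) = orient (q j) (q k) (q i) := by
    intro i j k h
    rw [orient_eq_sign_area, orient_eq_sign_area] at *
    rw [area_rotate (p i), area_rotate (q i), h]
  have heq : ∀ (i k : Fin n), orient (p i) (p i) (p k) = orient (q i) (q i) (q k) := by
    intro i k
    rw [orient_eq_sign_area, orient_eq_sign_area]
    simp [area]
  rcases lt_trichotomy i j with hij | rfl | hij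
  · rcases lt_trichotomy j k with hjk | rfl | hjk
    · exact h i j k hij hjk
    · exact hrot (hrot (heq j i))
    · rcases lt_trichotomy i k with hik | rfl | hik
      · exact hrot (hswap (h i k j hik hjk))
      · exact hrot (heq i j)
      · exact hrot (h k i j hik hij)
  · exact heq i k
  · rcases lt_trichotomy i k with hik | rfl | hik
    · exact hswap (h j i k hij hik)
    · exact hrot (heq i j)
    · rcases lt_trichotomy j k with hjk | rfl | hjk
      · exact hrot (hrot (h j k i hjk hik))
      · exact hrot (hrot (heq j i))
      · exact hrot (hrot (hswap (h k j i hjk hij)))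

lemma sign_mul_sign_neg_iff (a b : ℝ) : Real.sign a * Real.sign b < 0 ↔ a * b < 0 := by
  rcases lt_trichotomy a 0 with ha | ha | ha <;> rcases lt_trichotomy b 0 with hb | hb | hb <;>
  simp [Real.sign_of_neg, Real.sign_of_pos, mul_neg_iff, ha, hb, not_lt_of_gt, zero_lt_one]

lemma cross_iff_orient (a b c d : Plane) : Cross a b c d ↔
    orient a b c * orient a b d < 0 ∧ orient c d a * orient c d b < 0 := by
  simp only [orient_eq_sign_area, sign_mul_sign_neg_iff, Cross]

lemma OTIso.isCrossFree_iff {n : ℕ} {p q : Fin n → Plane} (h : OTIso p q)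
    (G : SimpleGraph (Fin n)) (σ : Equiv.Perm (Fin n)) :
    IsCrossFree G (p ∘ σ) ↔ IsCrossFree G (q ∘ σ) := by
  simp only [IsCrossFree, cross_iff_orient, Function.comp_apply, h.orient_eq]

/-- The stacked triangulation as a graph on `Fin n`. -/
def stackGraph (n : ℕ) (L : List (Finset ℕ)) : SimpleGraph (Fin n) where
  Adj u v := u ≠ v ∧ stackAdj L u v
  symm := ⟨fun _ _ h => ⟨h.1.symm, h.2.symm⟩⟩
  loopless := ⟨fun _ h => h.1 rfl⟩

/-- Extension of a tuple of points to all natural indices. -/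
def extendPoints {n : ℕ} (p : Fin n → Plane) (i : ℕ) : Plane :=
  if h : i < n then p ⟨i, h⟩ else 0

lemma extendPoints_of_lt {n : ℕ} (p : Fin n → Plane) {i : ℕ} (h : i < n) :
    extendPoints p i = p ⟨i, h⟩ := dif_pos h

lemma GenPos.genericBelow {n : ℕ} {p : Fin n → Plane} (h : GenPos p) :
    GenericBelow (extendPoints p) n := by
  intro i hi j hj k hk hij hjk hik
  rw [extendPoints_of_lt p hi, extendPoints_of_lt p hj, extendPoints_of_lt p hk]
  exact h.area_ne_zero (by simpa using hij) (by simpa using hik) (by simpa using hjk)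

lemma IsCrossFree.crossFree {n : ℕ} {L : List (Finset ℕ)} (hL : StackValid L)
    (hn : L.length + 4 = n) {p : Fin n → Plane} (h : IsCrossFree (stackGraph n L) p) :
    CrossFree L (extendPoints p) := by
  subst hn
  intro u v x y huv hxy
  have hu := huv.lt hL
  have hv := huv.symm.lt hL
  have hx := hxy.lt hL
  have hy := hxy.symm.lt hL
  rw [extendPoints_of_lt p hu, extendPoints_of_lt p hv, extendPoints_of_lt p hx,
    extendPoints_of_lt p hy]
  exact h ⟨u, hu⟩ ⟨v, hv⟩ ⟨x, hx⟩ ⟨y, hy⟩ ⟨by simpa using huv.ne hL, huv⟩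
    ⟨by simpa using hxy.ne hL, hxy⟩

lemma stackGraph_unique {n : ℕ} {L L' : List (Finset ℕ)} (hL : StackValid L) (hL' : StackValid L')
    (hn : L.length + 4 = n) (hn' : L'.length + 4 = n) {p : Fin n → Plane} (hp : GenPos p)
    (h : IsCrossFree (stackGraph n L) p) (h' : IsCrossFree (stackGraph n L') p) : L = L' :=
  stack_unique hL hL' (by omega) hp.genericBelow hn.le (h.crossFree hL hn) (h'.crossFree hL' hn')

lemma exists_genPos_isCrossFree {n : ℕ} {L : List (Finset ℕ)} (hL : StackValid L)
    (hn : L.length + 4 = n) :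
    ∃ p : Fin n → Plane, GenPos p ∧ IsCrossFree (stackGraph n L) p := by
  obtain ⟨g, hg⟩ : (stackFaces L).Nonempty := Finset.card_pos.1 (by rw [card_stackFaces hL]; omega)
  obtain ⟨p, hp, hc, -⟩ := exists_isDrawing hL hg
  refine ⟨fun i => p i, ?_, fun u v x y huv hxy => hc u v x y huv.2 hxy.2⟩
  intro i j k hij hik hjk
  rw [orient_eq_sign_area, Ne, Real.sign_eq_zero_iff]
  refine hp i (by omega) j (by omega) k (by omega) ?_ ?_ ?_ <;>
  rwa [Ne, Fin.val_inj]

/-- The codes of the stacked triangulations with `k + 4` vertices. -/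
def stackCodes : ℕ → Finset (List (Finset ℕ))
  | 0 => {[]}
  | k + 1 => (stackCodes k).biUnion fun L => (stackFaces L).image (· :: L)

lemma mem_stackCodes {k : ℕ} {L : List (Finset ℕ)} :
    L ∈ stackCodes k ↔ StackValid L ∧ L.length = k := by
  induction k generalizing L with
  | zero =>
    rw [stackCodes, Finset.mem_singleton, List.length_eq_zero_iff]
    exact ⟨fun h => ⟨h ▸ trivial, h⟩, fun h => h.2⟩
  | succ k ih =>
    simp only [stackCodes, Finset.mem_biUnion, Finset.mem_image, ih]
    constructor
    · rintro ⟨L, ⟨h1, rfl⟩, f, hf, rfl⟩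
      exact ⟨⟨hf, h1⟩, rfl⟩
    · rintro ⟨h1, h2⟩
      cases L with
      | nil => simp at h2
      | cons f L => exact ⟨L, ⟨h1.2, by simpa using h2⟩, f, h1.1, rfl⟩

lemma card_stackCodes (k : ℕ) : (stackCodes k).card = 2 ^ k * (k + 1).factorial := by
  induction k with
  | zero => rfl
  | succ k ih =>
    rw [stackCodes, Finset.card_biUnion]
    · have h : ∀ L ∈ stackCodes k, ((stackFaces L).image (· :: L)).card = 2 * k + 4 := by
        intro L hL
        obtain ⟨hv, rfl⟩ := mem_stackCodes.1 hL
        rw [Finset.card_image_of_injective _ fun f g h => (List.cons.inj h).1, card_stackFaces hv]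
      rw [Finset.sum_congr rfl h, Finset.sum_const, ih, Nat.factorial_succ (k + 1), smul_eq_mul]
      ring
    · intro L _ L' _ hne
      rw [Function.onFun, Finset.disjoint_left]
      intro M hM hM'
      obtain ⟨f, -, rfl⟩ := Finset.mem_image.1 hM
      obtain ⟨f', -, h⟩ := Finset.mem_image.1 hM'
      exact hne (List.cons.inj h).2.symm

/-- The type of labelled order types in general position. -/
abbrev LabelledOrderType (n : ℕ) := Quot fun p q : GPTuple n => OTIso p.1 q.1

instance finite_labelledOrderType (n : ℕ) : Finite (LabelledOrderType n) := by
  let F : LabelledOrderType n → Fin n → Fin n → Fin n → Prop :=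
    Quot.lift (fun p i j k => orient (p.1 i) (p.1 j) (p.1 k) = 1) fun p q h => by
      funext i j k
      rw [h.orient_eq]
  refine Finite.of_injective F fun o o' => ?_
  induction o using Quot.inductionOn with | _ p
  induction o' using Quot.inductionOn with | _ q
  intro h
  refine Quot.sound fun i j k hij hjk => ?_
  have hiff : orient (p.1 i) (p.1 j) (p.1 k) = 1 ↔ orient (q.1 i) (q.1 j) (q.1 k) = 1 :=
    iff_of_eq (congrFun (congrFun (congrFun h i) j) k)
  have hone : ∀ r : GPTuple n, orient (r.1 i) (r.1 j) (r.1 k) = -1 ∨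
      orient (r.1 i) (r.1 j) (r.1 k) = 1 := fun r => by
    have := r.2.2 i j k hij.ne (hij.trans hjk).ne hjk.ne
    rw [orient_eq_sign_area] at *
    exact Real.sign_apply_eq_of_ne_zero _ fun h0 => this (by rw [h0, Real.sign_zero])
  rcases hone p with hp | hp
  · rcases hone q with hq | hq
    · rw [hp, hq]
    · exact absurd (hiff.2 hq) (by rw [hp]; norm_num)
  · rw [hp, hiff.1 hp]

/-- The graph `G` is crossing-free on the order type `o` after relabelling by `σ`. -/
def DrawnOn {n : ℕ} (o : LabelledOrderType n) (σ : Equiv.Perm (Fin n))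
    (G : SimpleGraph (Fin n)) : Prop :=
  Quot.lift (fun p : GPTuple n => IsCrossFree G (p.1 ∘ σ))
    (fun _ _ h => propext (h.isCrossFree_iff G σ)) o

lemma DrawnOn.unique {n : ℕ} {o : LabelledOrderType n} {σ : Equiv.Perm (Fin n)}
    {L L' : List (Finset ℕ)}
    (hL : StackValid L) (hL' : StackValid L') (hn : L.length + 4 = n) (hn' : L'.length + 4 = n)
    (h : DrawnOn o σ (stackGraph n L)) (h' : DrawnOn o σ (stackGraph n L')) : L = L' := by
  induction o using Quot.inductionOn with | _ p
  refine stackGraph_unique hL hL' hn hn' (p := p.1 ∘ σ) ?_ h h'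
  intro i j k hij hik hjk
  exact p.2.2 _ _ _ (σ.injective.ne hij) (σ.injective.ne hik) (σ.injective.ne hjk)

/-- A simultaneously embeddable family can be drawn on a common order type, one given member
being drawn without relabelling. -/
lemma SimultaneouslyEmbeddable.exists_drawnOn {n : ℕ} (hn : 3 ≤ n) {𝒢 : Set (SimpleGraph (Fin n))}
    (h : SimultaneouslyEmbeddable 𝒢) {G₁ : SimpleGraph (Fin n)} (hG₁ : G₁ ∈ 𝒢) :
    ∃ o : LabelledOrderType n, DrawnOn o 1 G₁ ∧ ∀ G ∈ 𝒢, ∃ σ, DrawnOn o σ G := by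
  obtain ⟨p, hp, hall⟩ := h.exists_genPos
  obtain ⟨τ, hτ⟩ := hall G₁ hG₁
  have hpτ : GenPos (p ∘ τ) := fun i j k hij hik hjk =>
    hp _ _ _ (τ.injective.ne hij) (τ.injective.ne hik) (τ.injective.ne hjk)
  refine ⟨Quot.mk _ ⟨p ∘ τ, hpτ.injective hn, hpτ⟩, hτ, fun G hG => ?_⟩
  obtain ⟨σ, hσ⟩ := hall G hG
  refine ⟨τ⁻¹ * σ, ?_⟩
  have : (p ∘ τ) ∘ ⇑(τ⁻¹ * σ) = p ∘ σ := by
    funext i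
    simp
  change IsCrossFree G ((p ∘ τ) ∘ ⇑(τ⁻¹ * σ))
  rwa [this]

lemma card_stackCodes_le_tS {n : ℕ} (hn : 4 ≤ n) : (stackCodes (n - 4)).card ≤ tS n := by
  have hlen : ∀ L : stackCodes (n - 4), StackValid L.1 ∧ L.1.length + 4 = n := fun L => by
    obtain ⟨h1, h2⟩ := mem_stackCodes.1 L.2
    exact ⟨h1, by omega⟩
  have hex : ∀ L : stackCodes (n - 4), ∃ o : LabelledOrderType n,
      DrawnOn o 1 (stackGraph n L.1) := by
    intro L
    obtain ⟨p, hp, hc⟩ := exists_genPos_isCrossFree (hlen L).1 (hlen L).2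
    exact ⟨Quot.mk _ ⟨p, hp.injective (by omega), hp⟩, hc⟩
  choose F hF using hex
  have hinj : Function.Injective F := fun L L' h => Subtype.ext <|
    DrawnOn.unique (hlen L).1 (hlen L').1 (hlen L).2 (hlen L').2 (hF L) (h ▸ hF L')
  have := Nat.card_le_card_of_injective F hinj
  rwa [Nat.card_eq_fintype_card, Fintype.card_coe] at this

/-- If all families of `m + 1` stacked triangulations were simultaneously embeddable, there would
be many order types. -/
lemma pow_card_stackCodes_le {n : ℕ} (hn : 4 ≤ n) (m : ℕ)
    (h : ∀ 𝒢 : Finset (SimpleGraph (Fin n)), 𝒢.card ≤ m + 1 →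
      ¬ ConflictCollection (𝒢 : Set (SimpleGraph (Fin n)))) :
    (stackCodes (n - 4)).card ^ (m + 1) ≤ tS n * n.factorial ^ m := by
  classical
  have hlen : ∀ L : stackCodes (n - 4), StackValid L.1 ∧ L.1.length + 4 = n := fun L => by
    obtain ⟨h1, h2⟩ := mem_stackCodes.1 L.2
    exact ⟨h1, by omega⟩
  have hex : ∀ c : stackCodes (n - 4) × (Fin m → stackCodes (n - 4)),
      ∃ x : LabelledOrderType n × (Fin m → Equiv.Perm (Fin n)),
        DrawnOn x.1 1 (stackGraph n c.1.1) ∧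
          ∀ i, DrawnOn x.1 (x.2 i) (stackGraph n (c.2 i).1) := by
    rintro ⟨L, H⟩
    let 𝒢 : Finset (SimpleGraph (Fin n)) :=
      insert (stackGraph n L.1) (Finset.univ.image fun i => stackGraph n (H i).1)
    have hcard : 𝒢.card ≤ m + 1 := by
      refine (Finset.card_insert_le _ _).trans (Nat.succ_le_succ (Finset.card_image_le.trans ?_))
      simp
    have hplanar : ∀ M : stackCodes (n - 4), PlanarEmbeddable (stackGraph n M.1) := by
      intro M
      obtain ⟨p, hp, hc⟩ := exists_genPos_isCrossFree (hlen M).1 (hlen M).2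
      exact ⟨p, hc.isSLEmbedding (by omega) hp⟩
    have hsim : SimultaneouslyEmbeddable (𝒢 : Set (SimpleGraph (Fin n))) := by
      by_contra hsim
      refine h 𝒢 hcard ⟨fun G hG => ?_, hsim⟩
      rcases Finset.mem_insert.1 hG with rfl | hG
      · exact hplanar L
      · obtain ⟨i, -, rfl⟩ := Finset.mem_image.1 hG
        exact hplanar (H i)
    obtain ⟨o, ho, hall⟩ := hsim.exists_drawnOn (by omega) (Finset.mem_insert_self _ _)
    choose σ hσ using fun i => hall (stackGraph n (H i).1)
      (Finset.mem_insert_of_mem (Finset.mem_image_of_mem _ (Finset.mem_univ i)))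
    exact ⟨(o, σ), ho, hσ⟩
  choose F hF1 hF2 using hex
  have hinj : Function.Injective F := by
    rintro ⟨L, H⟩ ⟨L', H'⟩ hF
    refine Prod.ext (Subtype.ext ?_) (funext fun i => Subtype.ext ?_)
    · exact DrawnOn.unique (hlen L).1 (hlen L').1 (hlen L).2 (hlen L').2 (hF1 (L, H))
        (hF ▸ hF1 (L', H'))
    · exact DrawnOn.unique (hlen (H i)).1 (hlen (H' i)).1 (hlen (H i)).2 (hlen (H' i)).2
        (hF2 (L, H) i) (hF ▸ hF2 (L', H') i)
  have hcard := Nat.card_le_card_of_injective F hinj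
  simp only [Nat.card_prod, Nat.card_fun, Nat.card_fin,
    Nat.card_perm, Nat.card_eq_fintype_card (α := stackCodes (n - 4)), Fintype.card_coe] at hcard
  rw [pow_succ']
  exact hcard

lemma cubic_lt_two_pow {n : ℕ} (hn : 16 ≤ n) :
    16 * (n : ℝ) * ((n : ℝ) - 1) * ((n : ℝ) - 2) < 2 ^ n := by
  induction n, hn using Nat.le_induction with
  | base => norm_num
  | succ k hk ih =>
    have hk' : (16 : ℝ) ≤ k := by exact_mod_cast hk
    rw [pow_succ]
    push_cast
    have h : 0 ≤ (k : ℝ) * ((k : ℝ) - 1) * ((k : ℝ) - 5) :=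
      mul_nonneg (mul_nonneg (by linarith) (by linarith)) (by linarith)
    nlinarith

lemma factorial_eq_cubic_mul {n : ℕ} (hn : 3 ≤ n) :
    (n.factorial : ℝ) = (n : ℝ) * ((n : ℝ) - 1) * ((n : ℝ) - 2) * ((n - 3).factorial : ℝ) := by
  obtain ⟨k, rfl⟩ := Nat.exists_eq_add_of_le' hn
  rw [Nat.factorial_succ, Nat.factorial_succ, Nat.factorial_succ]
  push_cast [Nat.add_sub_cancel]
  ring

/-- For every `n ≥ 16` there exists a conflict collection of `n`-vertex graphs of
cardinality at most
`⌊(log₂ t_s(n,2) - (n-4) - log₂((n-3)!)) / (n - log₂(16n(n-1)(n-2)))⌋ + 2`. -/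
theorem conflict_collection_ordertype_bound (n : ℕ) (hn : 16 ≤ n) :
    ∃ 𝒢 : Finset (SimpleGraph (Fin n)),
      ConflictCollection (↑𝒢 : Set (SimpleGraph (Fin n))) ∧
      (𝒢.card : ℝ) ≤
        (⌊(Real.logb 2 (tS n) - ((n : ℝ) - 4) - Real.logb 2 (Nat.factorial (n - 3))) /
            ((n : ℝ) - Real.logb 2 (16 * (n : ℝ) * ((n : ℝ) - 1) * ((n : ℝ) - 2)))⌋ : ℝ)
          + 2 := by
  set D : ℝ := (n : ℝ) - Real.logb 2 (16 * (n : ℝ) * ((n : ℝ) - 1) * ((n : ℝ) - 2)) with hD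
  set Y : ℝ := Real.logb 2 (tS n) - ((n : ℝ) - 4) - Real.logb 2 (Nat.factorial (n - 3)) with hY
  have hn' : (16 : ℝ) ≤ n := by exact_mod_cast hn
  have hcubic : 0 < (n : ℝ) * ((n : ℝ) - 1) * ((n : ℝ) - 2) :=
    mul_pos (mul_pos (by linarith) (by linarith)) (by linarith)
  have hfac : ∀ k : ℕ, (0 : ℝ) < k.factorial := fun k => by exact_mod_cast k.factorial_pos
  have hDpos : 0 < D := by
    rw [hD, sub_pos, Real.logb_lt_iff_lt_rpow (by norm_num) (by linarith), Real.rpow_natCast]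
    exact cubic_lt_two_pow hn
  have hN : ((stackCodes (n - 4)).card : ℝ) = 2 ^ (n - 4) * ((n - 3).factorial : ℝ) := by
    rw [card_stackCodes, show n - 4 + 1 = n - 3 by omega]
    push_cast
    rfl
  have hNpos : (0 : ℝ) < (stackCodes (n - 4)).card := by
    rw [hN]
    exact mul_pos (by positivity) (hfac _)
  have hlogN : Real.logb 2 (stackCodes (n - 4)).card
      = ((n : ℝ) - 4) + Real.logb 2 (Nat.factorial (n - 3)) := by
    rw [hN, Real.logb_mul (by positivity) (hfac _).ne', Real.logb_pow,
      Real.logb_self_eq_one (by norm_num), Nat.cast_sub (by omega)]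
    norm_num
  have hlogfac : Real.logb 2 n.factorial = Real.logb 2 (stackCodes (n - 4)).card - D := by
    rw [hlogN, hD, factorial_eq_cubic_mul (by omega), Real.logb_mul hcubic.ne' (hfac _).ne',
      show 16 * (n : ℝ) * ((n : ℝ) - 1) * ((n : ℝ) - 2)
        = 2 ^ 4 * ((n : ℝ) * ((n : ℝ) - 1) * ((n : ℝ) - 2)) by ring,
      Real.logb_mul (by norm_num) hcubic.ne', Real.logb_pow, Real.logb_self_eq_one (by norm_num)]
    push_cast
    ring
  have hle : ((stackCodes (n - 4)).card : ℝ) ≤ tS n := by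
    exact_mod_cast card_stackCodes_le_tS (by omega)
  have hTpos : (0 : ℝ) < tS n := hNpos.trans_le hle
  have hYnonneg : 0 ≤ Y := by
    have := Real.logb_le_logb_of_le (b := 2) (by norm_num) hNpos hle
    rw [hY]
    linarith
  obtain ⟨m, hm⟩ := Int.eq_ofNat_of_zero_le
    (show 0 ≤ ⌊Y / D⌋ + 1 by
      have : 0 ≤ ⌊Y / D⌋ := Int.floor_nonneg.2 (div_nonneg hYnonneg hDpos.le)
      omega)
  have hm' : (⌊Y / D⌋ : ℝ) + 1 = m := by exact_mod_cast hm
  by_contra! hno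
  have hpow := pow_card_stackCodes_le (show 4 ≤ n by omega) m fun 𝒢 hcard hconf => by
    have h1 := hno 𝒢 hconf
    have h2 : (𝒢.card : ℝ) ≤ m + 1 := by exact_mod_cast hcard
    linarith
  have hpow' : ((stackCodes (n - 4)).card : ℝ) ^ (m + 1) ≤ tS n * (n.factorial : ℝ) ^ m := by
    exact_mod_cast hpow
  have hlog := Real.logb_le_logb_of_le (b := 2) (by norm_num) (by positivity) hpow'
  rw [Real.logb_mul hTpos.ne' (pow_pos (hfac n) m).ne', Real.logb_pow, Real.logb_pow,
    hlogfac] at hlog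
  push_cast at hlog
  have hmD : m * D ≤ Y := by
    rw [hY]
    linarith
  have hfl := Int.lt_floor_add_one (Y / D)
  rw [hm', div_lt_iff₀ hDpos] at hfl
  linarith
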